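/- arXiv:2601.05863 — 2 statements merged into one kernel-verified Lean document; each statement's English description precedes it below -/
import Mathlib

section
/- Let Z be a compact subset of the unit sphere S² of ℝ³ and for i = 1,…,N let Ψᵢ : Z → ℝ³ be continuous functions which are tangent to the sphere, i.e. ⟨Ψᵢ(z), z⟩ = 0 for every z ∈ Z. Suppose there exists a continuous function x : [0,∞) → Z and Lebesgue measurable functions u₁,…,u_N : [0,∞) → [0,1] with Σᵢ uᵢ(s) = 1 a.e. such that x(t) = x(0) + ∫₀ᵗ Σᵢ uᵢ(s)Ψᵢ(x(s)) ds for all t ≥ 0. Then there exist a p-periodic (for some p > 0) continuous function y : [0,∞) → ℝ³ taking values in the ω-limit set ω(x), and Lebesgue measurable functions v₁,…,v_N : [0,∞) → [0,1] which are p-periodic a.e. and satisfy Σᵢ vᵢ(s) = 1 a.e., such that y(t) = y(0) + ∫₀ᵗ Σᵢ vᵢ(s)Ψᵢ(y(s)) ds for all t ≥ 0. -/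
open scoped NNReal RealInnerProductSpace
open Filter Topology MeasureTheory

/-- A switching law: measurable functions `u₁,…,u_N : [0,∞) → [0,1]` with `Σᵢ uᵢ(s) = 1`
for a.e. `s ≥ 0` (the `uᵢ` are extended measurably to all of `ℝ`). -/
def IsSwitchingLaw {N : ℕ} (u : Fin N → ℝ → ℝ) : Prop :=
  (∀ i, Measurable (u i)) ∧
  (∀ᵐ s ∂(volume.restrict (Set.Ici (0 : ℝ))),
    (∀ i, u i s ∈ Set.Icc (0 : ℝ) 1) ∧ ∑ i, u i s = 1)

theorem lt_of_crossing_upward {φ : ℝ → ℝ} {a b c : ℝ} (hab : a ≤ b)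
    (hφ : ContinuousOn φ (Set.Icc a b)) (ha : c < φ a)
    (hcross : ∀ t ∈ Set.Ioc a b, φ t = c → ∀ᶠ s in 𝓝[<] t, φ s < c) : c < φ b := by
  by_contra! hb
  set S := Set.Icc a b ∩ φ ⁻¹' Set.Iic c with hS
  have hSc : IsCompact S :=
    isCompact_Icc.of_isClosed_subset (hφ.preimage_isClosed_of_isClosed isClosed_Icc isClosed_Iic)
      Set.inter_subset_left
  obtain ⟨t, ⟨ht, htc⟩, hmin⟩ := hSc.exists_isMinOn ⟨b, ⟨hab, le_rfl⟩, hb⟩ continuousOn_id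
  have htc' : φ t ≤ c := htc
  have hat : a < t := lt_of_le_of_ne ht.1 (by rintro rfl; linarith)
  have hbefore : ∀ s ∈ Set.Ico a t, c < φ s := by
    intro s hs
    by_contra! h
    have : t ≤ s := hmin ⟨⟨hs.1, hs.2.le.trans ht.2⟩, h⟩
    exact absurd hs.2 this.not_gt
  have hev : ∀ᶠ s in 𝓝[<] t, s ∈ Set.Ico a t := Ico_mem_nhdsLT hat
  have hcont : Tendsto φ (𝓝[<] t) (𝓝 (φ t)) :=
    (hφ t ht).mono_left (nhdsWithin_le_of_mem (mem_of_superset hev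
      fun s hs => ⟨hs.1, hs.2.le.trans ht.2⟩))
  have htc2 : φ t = c := le_antisymm htc'
    (ge_of_tendsto hcont (hev.mono fun s hs => (hbefore s hs).le))
  obtain ⟨s, hs1, hs2⟩ := ((hcross t ⟨hat, ht.2⟩ htc2).and hev).exists
  exact absurd hs1 (hbefore s hs2).not_gt

theorem sin_add_odd_mul_pi (x : ℝ) (k : ℤ) :
    Real.sin (x + (2 * k + 1) * Real.pi) = -Real.sin x := by
  rw [show x + (2 * k + 1) * Real.pi = (x + Real.pi) + k * (2 * Real.pi) by ring,
    Real.sin_add_int_mul_two_pi, Real.sin_add_pi]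

theorem lt_odd_mul_pi_of_sin_pos {φ : ℝ → ℝ} (hφ : ContinuousOn φ (Set.Icc 0 1)) {k : ℤ}
    (h0 : φ 0 = (2 * k + 1) * Real.pi) (hsin : ∀ t ∈ Set.Ioc (0 : ℝ) 1, 0 < Real.sin (φ t)) :
    φ 1 < (2 * k + 1) * Real.pi := by
  by_contra! h
  have h1 := hsin 1 (by simp)
  have h2 : φ 0 + Real.pi / 2 ≤ φ 1 := by
    by_contra! h3
    rw [← sub_add_cancel (φ 1) ((2 * k + 1) * Real.pi), sin_add_odd_mul_pi] at h1
    have := Real.sin_nonneg_of_nonneg_of_le_pi (sub_nonneg.2 h)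
      (by linarith [Real.pi_pos])
    linarith
  obtain ⟨t, ht, hte⟩ := intermediate_value_Icc zero_le_one hφ
    (show φ 0 + Real.pi / 2 ∈ Set.Icc (φ 0) (φ 1) from ⟨by linarith [Real.pi_pos], h2⟩)
  have ht0 : 0 < t := lt_of_le_of_ne ht.1 (by rintro rfl; linarith [Real.pi_pos])
  have := hsin t ⟨ht0, ht.2⟩
  rw [hte, h0, add_comm, sin_add_odd_mul_pi, Real.sin_pi_div_two] at this
  linarith

theorem odd_mul_pi_lt_of_sin_neg {φ : ℝ → ℝ} (hφ : ContinuousOn φ (Set.Icc 0 1)) {k : ℤ}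
    (h0 : φ 0 = (2 * k + 1) * Real.pi) (hsin : ∀ t ∈ Set.Ioc (0 : ℝ) 1, Real.sin (φ t) < 0) :
    (2 * k + 1) * Real.pi < φ 1 := by
  have := lt_odd_mul_pi_of_sin_pos (φ := fun t => -φ t) (k := -k - 1) hφ.neg
    (by rw [h0]; push_cast; ring) (fun t ht => by simpa using hsin t ht)
  push_cast at this
  linarith

theorem exists_continuousOn_log_div {w : ℝ → ℂ} {a b : ℝ} (hab : a ≤ b)
    (hw : ContinuousOn w (Set.Icc a b)) {Q : Set ℂ} (hQ : IsCompact Q)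
    (hd : Disjoint Q (w '' Set.Icc a b)) :
    ∃ Λ : ℂ → ℂ, ContinuousOn Λ Q ∧ ∀ z ∈ Q, Complex.exp (Λ z) = (w b - z) / (w a - z) := by
  obtain ⟨r, hr, hrd⟩ := Metric.exists_pos_forall_lt_edist hQ
    (isCompact_Icc.image_of_continuousOn hw).isClosed hd
  have hdist : ∀ z ∈ Q, ∀ t ∈ Set.Icc a b, (r : ℝ) < ‖w t - z‖ := by
    intro z hz t ht
    have := hrd z hz (w t) ⟨t, ht, rfl⟩
    rw [edist_comm, edist_nndist, ENNReal.coe_lt_coe] at this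
    rw [← dist_eq_norm]
    exact_mod_cast this
  obtain ⟨ε, hε, hwε⟩ := Metric.uniformContinuousOn_iff.1
    (isCompact_Icc.uniformContinuousOn_of_continuous hw) r hr
  obtain ⟨n, hn⟩ := exists_nat_gt ((b - a) / ε)
  have hn0 : (0 : ℝ) < n := lt_of_le_of_lt (div_nonneg (sub_nonneg.2 hab) hε.le) hn
  set s : ℕ → ℝ := fun j => a + j * ((b - a) / n) with hsdef
  have hs : ∀ j ≤ n, s j ∈ Set.Icc a b := by
    intro j hj
    have h1 : (j : ℝ) * ((b - a) / n) ≤ n * ((b - a) / n) := by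
      have : 0 ≤ (b - a) / n := div_nonneg (sub_nonneg.2 hab) hn0.le
      gcongr
    have h2 : (n : ℝ) * ((b - a) / n) = b - a := by field_simp
    have h3 : 0 ≤ (j : ℝ) * ((b - a) / n) :=
      mul_nonneg (Nat.cast_nonneg _) (div_nonneg (sub_nonneg.2 hab) hn0.le)
    constructor <;> simp only [hsdef] <;> linarith
  have hstep : ∀ j < n, dist (w (s (j + 1))) (w (s j)) < r := by
    intro j hj
    refine hwε _ (hs _ hj) _ (hs _ hj.le) ?_
    have : s (j + 1) - s j = (b - a) / n := by simp only [hsdef]; push_cast; ring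
    rw [Real.dist_eq, this, abs_of_nonneg (div_nonneg (sub_nonneg.2 hab) hn0.le)]
    rw [div_lt_iff₀ hε] at hn
    rw [div_lt_iff₀ hn0]
    linarith
  have hne : ∀ z ∈ Q, ∀ j ≤ n, w (s j) - z ≠ 0 := fun z hz j hj h => by
    have := hdist z hz _ (hs j hj)
    rw [h, norm_zero] at this
    exact absurd this (not_lt.2 r.2)
  refine ⟨fun z => ∑ j ∈ Finset.range n, Complex.log ((w (s (j + 1)) - z) / (w (s j) - z)),
    ?_, ?_⟩
  · refine continuousOn_finsetSum _ fun j hj => ?_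
    have hj := Finset.mem_range.1 hj
    refine ContinuousOn.clog ?_ ?_
    · exact (by fun_prop : ContinuousOn (fun z => w (s (j + 1)) - z) Q).div
        (by fun_prop) fun z hz => hne z hz j hj.le
    · intro z hz
      rw [show (w (s (j + 1)) - z) / (w (s j) - z)
        = 1 + (w (s (j + 1)) - w (s j)) / (w (s j) - z) by
          field_simp [hne z hz j hj.le]; ring]
      apply Complex.mem_slitPlane_of_norm_lt_one
      rw [norm_div, div_lt_one (norm_pos_iff.2 (hne z hz j hj.le)), ← dist_eq_norm]
      exact (hstep j hj).trans (hdist z hz _ (hs j hj.le))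
  · intro z hz
    have key : ∀ m ≤ n, Complex.exp (∑ j ∈ Finset.range m,
        Complex.log ((w (s (j + 1)) - z) / (w (s j) - z))) = (w (s m) - z) / (w (s 0) - z) := by
      intro m
      induction m with
      | zero => intro _; simp [div_self (hne z hz 0 (Nat.zero_le _))]
      | succ m ih =>
        intro hm
        rw [Finset.sum_range_succ, Complex.exp_add, ih (by omega), Complex.exp_log
          (div_ne_zero (hne z hz _ hm) (hne z hz _ (by omega)))]
        field_simp [hne z hz m (by omega), hne z hz 0 (by omega)]
    have h0 : s 0 = a := by simp [hsdef]
    have h1 : s n = b := by simp only [hsdef]; field_simp; ring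
    simpa only [h0, h1] using key n le_rfl

theorem exp_re_mul_sin_im {Λ z : ℂ} {β : ℝ} (hz : z ≠ 0)
    (h : Complex.exp Λ = (β * Complex.I - z) / (0 - z)) :
    Real.exp Λ.re * Real.sin Λ.im = -(β * z.re / Complex.normSq z) := by
  rw [← Complex.exp_im, h, show (β * Complex.I - z) / (0 - z) = 1 - β * Complex.I * z⁻¹ by
    field_simp; ring]
  simp [Complex.inv_re, Complex.inv_im]
  ring

/-- A planar curve whose real part increases at a definite rate while it stays in the ball of
radius `r` around the origin. -/
def IncreasesNearZero (w : ℝ → ℂ) (r c : ℝ) : Prop :=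
  ∀ s t, 0 < s → s ≤ t → (∀ τ ∈ Set.Icc s t, ‖w τ‖ < r) → c * (t - s) ≤ (w t).re - (w s).re

theorem IncreasesNearZero.exists_ball {w : ℝ → ℂ} {r c : ℝ} (h : IncreasesNearZero w r c)
    (hc : 0 < c) (hw : ContinuousOn w (Set.Ioi 0)) {t : ℝ} (ht : 0 < t) (htr : ‖w t‖ < r) :
    ∃ ε > 0, (∀ s, t - ε ≤ s → s < t → (w s).re < (w t).re) ∧
      ∀ s, t < s → s ≤ t + ε → (w t).re < (w s).re := by
  have hev : ∀ᶠ s in 𝓝 t, 0 < s ∧ ‖w s‖ < r :=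
    (lt_mem_nhds ht).and
      (((hw.continuousAt (Ioi_mem_nhds ht)).norm).eventually (gt_mem_nhds htr))
  obtain ⟨ε, hε, hball⟩ := Metric.nhds_basis_closedBall.eventually_iff.1 hev
  have hb : ∀ s, t - ε ≤ s → s ≤ t + ε → 0 < s ∧ ‖w s‖ < r := fun s h1 h2 =>
    hball (by rw [Metric.mem_closedBall, Real.dist_eq, abs_le]; constructor <;> linarith)
  refine ⟨ε, hε, fun s h1 h2 => ?_, fun s h1 h2 => ?_⟩
  · have := h s t (hb s h1 (by linarith)).1 h2.le
      fun τ hτ => (hb τ (by linarith [hτ.1]) (by linarith [hτ.2])).2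
    have h3 : 0 < c * (t - s) := mul_pos hc (by linarith)
    linarith
  · have := h t s ht h1.le
      fun τ hτ => (hb τ (by linarith [hτ.1]) (by linarith [hτ.2])).2
    have h3 : 0 < c * (s - t) := mul_pos hc (by linarith)
    linarith

theorem exists_norm_sub_gt_of_disjoint {K C : Set ℂ} (hK : IsCompact K) (hC : IsCompact C)
    (hd : Disjoint K C) : ∃ δ : ℝ, 0 < δ ∧ ∀ p ∈ K, ∀ q ∈ C, δ < ‖q - p‖ := by
  obtain ⟨r, hr, hrd⟩ := Metric.exists_pos_forall_lt_edist hK hC.isClosed hd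
  refine ⟨r, by exact_mod_cast hr, fun p hp q hq => ?_⟩
  have := hrd p hp q hq
  rw [edist_comm, edist_nndist, ENNReal.coe_lt_coe] at this
  rw [← dist_eq_norm]
  exact_mod_cast this

/-- The point at parameter `l` of the segment from `m` to `p`. -/
def segmentPoint (m p : ℂ) (l : ℝ) : ℂ := m + l * (p - m)

theorem continuous_segmentPoint (m p : ℂ) : Continuous (segmentPoint m p) := by
  unfold segmentPoint; fun_prop

theorem notMem_of_segmentPoint_near {m p p' : ℂ} {C : Set ℂ} {δ : ℝ}
    (hδ : ∀ z ∈ segmentPoint m p' '' Set.Icc 0 1, ∀ q ∈ C, δ < ‖q - z‖) (hp : ‖p - p'‖ < δ)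
    {l : ℝ} (hl : l ∈ Set.Icc (0 : ℝ) 1) : segmentPoint m p l ∉ C := by
  intro h
  have h1 := hδ _ ⟨l, hl, rfl⟩ _ h
  have h2 : segmentPoint m p l - segmentPoint m p' l = l * (p - p') := by
    simp only [segmentPoint]; ring
  rw [h2, norm_mul, Complex.norm_real, Real.norm_eq_abs, abs_of_nonneg hl.1] at h1
  nlinarith [norm_nonneg (p - p'), hl.2]

set_option maxHeartbeats 1000000 in
theorem not_recurrent_of_first_return {w : ℝ → ℂ} {t₁ r c β : ℝ} (hc : 0 < c)
    (hw : ContinuousOn w (Set.Ioi 0)) (hinj : Set.InjOn w (Set.Ioi 0))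
    (hrec : ∀ s > 0, ∀ T, ∀ ε > 0, ∃ t > T, dist (w t) (w s) < ε) (h1 : w 1 = 0)
    (hmono : IncreasesNearZero w r c) (ht₁ : 1 < t₁) (hβ : 0 < β) (hβr : β < r)
    (hwt₁ : w t₁ = β * Complex.I)
    (hfirst : ∀ t ∈ Set.Ioo 1 t₁, (w t).re = 0 → 0 ≤ (w t).im → β < (w t).im) : False := by
  have hpos : ∀ {s t : ℝ}, 0 < s → Set.Icc s t ⊆ Set.Ioi 0 := fun hs x hx => hs.trans_le hx.1
  have hr : 0 < r := hβ.trans hβr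
  have ht₁0 : 0 < t₁ := by linarith
  set m : ℂ := (β / 2 : ℝ) * Complex.I with hm
  have hmre : m.re = 0 := by simp [hm]
  have hmim : m.im = β / 2 := by simp [hm]
  have hw1re : (w 1).re = 0 := by simp [h1]
  have hw1im : (w 1).im = 0 := by simp [h1]
  have hwt₁re : (w t₁).re = 0 := by simp [hwt₁]
  have hwt₁im : (w t₁).im = β := by simp [hwt₁]
  have hline_re : ∀ p l, (segmentPoint m p l).re = l * p.re := by
    intro p l; simp [segmentPoint, hmre]
  have hline_im : ∀ p l, (segmentPoint m p l).im = β / 2 + l * (p.im - β / 2) := by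
    intro p l; simp [segmentPoint, hmim]
  have hline_zero : ∀ p, segmentPoint m p 0 = m := by intro p; simp [segmentPoint]
  have hline_one : ∀ p, segmentPoint m p 1 = p := by intro p; simp [segmentPoint]
  have hsegc : ∀ p, IsCompact (segmentPoint m p '' Set.Icc 0 1) := fun p =>
    isCompact_Icc.image (continuous_segmentPoint m p)
  -- the starting point of the arc
  obtain ⟨ε₁, hε₁, hbefore1, hafter1⟩ := hmono.exists_ball hc hw one_pos (by simpa [h1] using hr)
  obtain ⟨ε₂, hε₂, hbefore2, hafter2⟩ := hmono.exists_ball hc hw ht₁0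
    (by rw [hwt₁]; simpa [abs_of_pos hβ] using hβr)
  rw [hw1re] at hbefore1 hafter1
  rw [hwt₁re] at hbefore2 hafter2
  obtain ⟨δ₁, hδ₁, hsep1⟩ := exists_norm_sub_gt_of_disjoint (hsegc 0)
    (isCompact_Icc.image_of_continuousOn (hw.mono (hpos (s := 1 + ε₁) (t := t₁) (by linarith))))
    (by
      rw [Set.disjoint_left]
      rintro _ ⟨l, hl, rfl⟩ ⟨t, ht, hwt⟩
      have e1 : (w t).re = 0 := by rw [hwt, hline_re]; simp
      have e2 : (w t).im = β / 2 - l * (β / 2) := by rw [hwt, hline_im]; simp; ring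
      rcases ht.2.eq_or_lt with rfl | hlt
      · rw [hwt₁im] at e2; nlinarith [hl.1]
      · have := hfirst t ⟨by linarith [ht.1], hlt⟩ e1 (by rw [e2]; nlinarith [hl.2])
        nlinarith [hl.1])
  obtain ⟨δ₂, hδ₂, hsep2⟩ := exists_norm_sub_gt_of_disjoint (hsegc (w t₁))
    (isCompact_Icc.image_of_continuousOn (hw.mono (hpos (s := 1) (t := t₁ - ε₂) one_pos)))
    (by
      rw [Set.disjoint_left]
      rintro _ ⟨l, hl, rfl⟩ ⟨t, ht, hwt⟩
      have e1 : (w t).re = 0 := by rw [hwt, hline_re, hwt₁re]; simp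
      have e2 : (w t).im = β / 2 + l * (β / 2) := by rw [hwt, hline_im, hwt₁im]; ring
      rcases ht.1.eq_or_lt with rfl | hlt
      · rw [hw1im] at e2; nlinarith [hl.1]
      · have := hfirst t ⟨hlt, by linarith [ht.2]⟩ e1 (by rw [e2]; nlinarith [hl.1])
        nlinarith [hl.2])
  -- a point just after the arc
  obtain ⟨t₂, ht₂, ht₂δ, ht₂re⟩ : ∃ t₂ > t₁, ‖w t₂ - w t₁‖ < δ₂ ∧ 0 < (w t₂).re := by
    have h2 : ∀ᶠ s in 𝓝[>] t₁, ‖w s - w t₁‖ < δ₂ := by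
      have := (hw.continuousAt (Ioi_mem_nhds ht₁0)).eventually (Metric.ball_mem_nhds _ hδ₂)
      filter_upwards [nhdsWithin_le_nhds this] with s hs using by rwa [← dist_eq_norm]
    have h3 : ∀ᶠ s in 𝓝[>] t₁, s ∈ Set.Ioc t₁ (t₁ + ε₂) := Ioc_mem_nhdsGT (by linarith)
    obtain ⟨s, hs2, hs3⟩ := (h2.and h3).exists
    exact ⟨s, hs3.1, hs2, hafter2 s hs3.1 hs3.2⟩
  -- a later point just before the start of the arc
  obtain ⟨s₀, hs₀, hs₀δ, hs₀re⟩ : ∃ s₀ > 0, ‖w s₀‖ < δ₁ / 2 ∧ (w s₀).re < 0 := by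
    have h2 : ∀ᶠ s in 𝓝[<] (1 : ℝ), ‖w s‖ < δ₁ / 2 := by
      have := (hw.continuousAt (Ioi_mem_nhds one_pos)).eventually
        (Metric.ball_mem_nhds _ (half_pos hδ₁))
      filter_upwards [nhdsWithin_le_nhds this] with s hs
      simpa [h1] using hs
    have h3 : ∀ᶠ s in 𝓝[<] (1 : ℝ), s ∈ Set.Ico (1 - ε₁) 1 := Ico_mem_nhdsLT (by linarith)
    have h4 : ∀ᶠ s in 𝓝[<] (1 : ℝ), s ∈ Set.Ico (0.5 : ℝ) 1 := Ico_mem_nhdsLT (by norm_num)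
    obtain ⟨s, hs2, hs3, hs4⟩ := (h2.and (h3.and h4)).exists
    exact ⟨s, by norm_num at hs4; linarith [hs4.1], hs2, hbefore1 s hs3.1 hs3.2⟩
  obtain ⟨T, hT, hTs₀⟩ := hrec s₀ hs₀ t₂ (min (δ₁ / 2) (-(w s₀).re))
    (lt_min (half_pos hδ₁) (by linarith))
  rw [dist_eq_norm, lt_min_iff] at hTs₀
  have hTre : (w T).re < 0 := by
    have := (Complex.abs_re_le_norm (w T - w s₀)).trans_lt hTs₀.2
    rw [Complex.sub_re, abs_lt] at this
    linarith
  have hTδ : ‖w T - 0‖ < δ₁ := by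
    rw [sub_zero]
    calc ‖w T‖ = ‖(w T - w s₀) + w s₀‖ := by simp
      _ ≤ _ := norm_add_le _ _
      _ < δ₁ := by linarith
  -- the connecting paths avoid the arc
  have hm_notMem : m ∉ w '' Set.Icc 1 t₁ := by
    rintro ⟨t, ht, hwt⟩
    rcases ht.1.eq_or_lt with rfl | hlt
    · rw [← hwt, hw1im] at hmim; linarith
    rcases ht.2.eq_or_lt with rfl | hlt'
    · rw [← hwt, hwt₁im] at hmim; linarith
    have := hfirst t ⟨hlt, hlt'⟩ (by rw [hwt, hmre]) (by rw [hwt, hmim]; linarith)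
    rw [hwt, hmim] at this
    linarith
  have hlow : ∀ l ∈ Set.Icc (0 : ℝ) 1, segmentPoint m (w T) l ∉ w '' Set.Icc 1 t₁ := by
    rintro l hl ⟨t, ht, hwt⟩
    rcases hl.1.eq_or_lt with rfl | hl0
    · exact hm_notMem ⟨t, ht, by rw [hwt, hline_zero]⟩
    rcases le_total (1 + ε₁) t with h | h
    · exact notMem_of_segmentPoint_near hsep1 hTδ hl ⟨t, ⟨h, ht.2⟩, hwt⟩
    · have hneg : (w t).re < 0 := by rw [hwt, hline_re]; nlinarith
      rcases ht.1.eq_or_lt with rfl | hlt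
      · linarith
      · linarith [hafter1 t hlt h]
  have hupp : ∀ l ∈ Set.Icc (0 : ℝ) 1, segmentPoint m (w t₂) l ∉ w '' Set.Icc 1 t₁ := by
    rintro l hl ⟨t, ht, hwt⟩
    rcases hl.1.eq_or_lt with rfl | hl0
    · exact hm_notMem ⟨t, ht, by rw [hwt, hline_zero]⟩
    rcases le_total t (t₁ - ε₂) with h | h
    · exact notMem_of_segmentPoint_near hsep2 ht₂δ hl ⟨t, ⟨ht.1, h⟩, hwt⟩
    · have hneg : 0 < (w t).re := by rw [hwt, hline_re]; nlinarith
      rcases ht.2.eq_or_lt with rfl | hlt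
      · linarith
      · linarith [hbefore2 t h hlt]
  set Q : Set ℂ := w '' Set.Icc t₂ T ∪ (segmentPoint m (w T) '' Set.Icc 0 1 ∪
    segmentPoint m (w t₂) '' Set.Icc 0 1) with hQdef
  have hQ : IsCompact Q :=
    (isCompact_Icc.image_of_continuousOn (hw.mono (hpos (by linarith)))).union
      ((hsegc _).union (hsegc _))
  have hQd : Disjoint Q (w '' Set.Icc 1 t₁) := by
    rw [Set.disjoint_left]
    rintro z (⟨t, ht, rfl⟩ | ⟨l, hl, rfl⟩ | ⟨l, hl, rfl⟩)
    · rintro ⟨s, hs, hst⟩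
      have := hinj (Set.mem_Ioi.2 (by linarith [hs.1])) (Set.mem_Ioi.2 (by linarith [ht.1])) hst
      linarith [hs.2, ht.1]
    · exact hlow l hl
    · exact hupp l hl
  obtain ⟨Λ, hΛ, hexp⟩ := exists_continuousOn_log_div ht₁.le (hw.mono (hpos one_pos)) hQ hQd
  rw [h1, hwt₁] at hexp
  have hne : ∀ z ∈ Q, z ≠ 0 := by
    rintro z hz rfl
    exact Set.disjoint_left.1 hQd hz ⟨1, ⟨le_rfl, ht₁.le⟩, h1⟩
  have hsin_pos : ∀ z ∈ Q, z.re < 0 → 0 < Real.sin (Λ z).im := by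
    intro z hz hre
    have h2 := exp_re_mul_sin_im (hne z hz) (hexp z hz)
    have h3 : 0 < -(β * z.re / Complex.normSq z) := by
      rw [neg_pos]
      exact div_neg_of_neg_of_pos (by nlinarith) (Complex.normSq_pos.2 (hne z hz))
    rw [← h2] at h3
    exact pos_of_mul_pos_right h3 (Real.exp_pos _).le
  have hsin_neg : ∀ z ∈ Q, 0 < z.re → Real.sin (Λ z).im < 0 := by
    intro z hz hre
    have h2 := exp_re_mul_sin_im (hne z hz) (hexp z hz)
    have h3 : 0 < β * z.re / Complex.normSq z :=
      div_pos (by nlinarith) (Complex.normSq_pos.2 (hne z hz))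
    by_contra! h4
    nlinarith [mul_nonneg (Real.exp_pos (Λ z).re).le h4]
  have hΛim : ContinuousOn (fun z => (Λ z).im) Q := Complex.continuous_im.comp_continuousOn hΛ
  have hlowQ : Set.MapsTo (segmentPoint m (w T)) (Set.Icc 0 1) Q := fun l hl =>
    Or.inr (Or.inl ⟨l, hl, rfl⟩)
  have huppQ : Set.MapsTo (segmentPoint m (w t₂)) (Set.Icc 0 1) Q := fun l hl =>
    Or.inr (Or.inr ⟨l, hl, rfl⟩)
  have hmQ : m ∈ Q := by
    have := hlowQ (x := 0) (by simp)
    rwa [hline_zero] at this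
  obtain ⟨k, hk⟩ : ∃ k : ℤ, (Λ m).im = (2 * k + 1) * Real.pi := by
    have h2 : Complex.exp (Λ m) = Complex.exp (Real.pi * Complex.I) := by
      have hβ' : (β : ℂ) ≠ 0 := by exact_mod_cast hβ.ne'
      rw [hexp m hmQ, Complex.exp_pi_mul_I, hm]
      push_cast
      field_simp
      ring
    obtain ⟨n, hn⟩ := Complex.exp_eq_exp_iff_exists_int.1 h2
    refine ⟨n, ?_⟩
    rw [hn]
    simp
    ring
  have hend : (Λ (w T)).im < (2 * k + 1) * Real.pi := by
    have := lt_odd_mul_pi_of_sin_pos (φ := fun l => (Λ (segmentPoint m (w T) l)).im) (k := k)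
      (hΛim.comp (continuous_segmentPoint _ _).continuousOn hlowQ)
      (by simpa only [hline_zero] using hk)
      (fun l hl => hsin_pos _ (hlowQ ⟨hl.1.le, hl.2⟩) (by rw [hline_re]; nlinarith [hl.1]))
    simpa only [hline_one] using this
  have hstart : (2 * k + 1) * Real.pi < (Λ (w t₂)).im := by
    have := odd_mul_pi_lt_of_sin_neg (φ := fun l => (Λ (segmentPoint m (w t₂) l)).im) (k := k)
      (hΛim.comp (continuous_segmentPoint _ _).continuousOn huppQ)
      (by simpa only [hline_zero] using hk)
      (fun l hl => hsin_neg _ (huppQ ⟨hl.1.le, hl.2⟩) (by rw [hline_re]; nlinarith [hl.1]))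
    simpa only [hline_one] using this
  have hwQ : Set.MapsTo w (Set.Icc t₂ T) Q := fun t ht => Or.inl ⟨t, ht, rfl⟩
  have hφ : ContinuousOn (fun t => (Λ (w t)).im) (Set.Icc t₂ T) :=
    hΛim.comp (hw.mono (hpos (by linarith))) hwQ
  have := lt_of_crossing_upward (le_of_lt hT) hφ hstart ?_
  · linarith
  intro t ht hte
  have ht' : t ∈ Set.Icc t₂ T := ⟨ht.1.le, ht.2⟩
  have ht0 : 0 < t := by linarith [ht.1]
  -- the curve is on the open segment
  obtain ⟨hre, him⟩ : (w t).re = 0 ∧ |(w t).im| < r := by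
    have h2 := exp_re_mul_sin_im (hne _ (hwQ ht')) (hexp _ (hwQ ht'))
    have hs : Real.sin (Λ (w t)).im = 0 := by
      rw [hte, ← zero_add ((2 * (k : ℝ) + 1) * Real.pi), sin_add_odd_mul_pi]; simp
    have hn := Complex.normSq_pos.2 (hne _ (hwQ ht'))
    have hre : (w t).re = 0 := by
      rw [hs, mul_zero, eq_comm, neg_eq_zero, div_eq_zero_iff] at h2
      rcases h2 with h2 | h2
      · exact (mul_eq_zero.1 h2).resolve_left hβ.ne'
      · exact absurd h2 hn.ne'
    refine ⟨hre, ?_⟩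
    have hcos : Real.cos (Λ (w t)).im = -1 := by
      rw [hte, show (2 * (k : ℝ) + 1) * Real.pi = Real.pi + k * (2 * Real.pi) by ring,
        Real.cos_add_int_mul_two_pi, Real.cos_pi]
    have h3 := hexp _ (hwQ ht')
    rw [eq_div_iff (by simpa using hne _ (hwQ ht'))] at h3
    have h4 := congrArg Complex.im h3
    simp only [Complex.mul_im, Complex.exp_re, Complex.exp_im, hs, hcos, hre, zero_sub,
      Complex.sub_im, Complex.neg_im, Complex.neg_re, Complex.ofReal_re, Complex.ofReal_im,
      Complex.I_re, Complex.I_im] at h4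
    have h5 := Real.exp_pos (Λ (w t)).re
    have h6 : (Real.exp (Λ (w t)).re + 1) * (w t).im = β := by linarith
    have h7 : 0 < (w t).im := pos_of_mul_pos_right (h6 ▸ hβ) (by linarith)
    rw [abs_of_pos h7]
    nlinarith
  obtain ⟨ε, hε, hbef, -⟩ := hmono.exists_ball hc hw ht0 (by
    rw [← Complex.re_add_im (w t), hre]; simpa using him)
  have h2 : ∀ᶠ s in 𝓝[<] t, s ∈ Set.Ico (max t₂ (t - ε)) t :=
    Ico_mem_nhdsLT (max_lt ht.1 (by linarith))
  have h3 : ∀ᶠ s in 𝓝[<] t, (2 * k + 1) * Real.pi - Real.pi < (Λ (w s)).im ∧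
      (Λ (w s)).im < (2 * k + 1) * Real.pi + Real.pi := by
    have hsub : Set.Icc t₂ T ∈ 𝓝[<] t := mem_of_superset (Ico_mem_nhdsLT ht.1)
      fun s hs => ⟨hs.1, hs.2.le.trans ht.2⟩
    have h4 : Tendsto (fun s => (Λ (w s)).im) (𝓝[<] t) (𝓝 ((2 * k + 1) * Real.pi)) := by
      rw [← hte]; exact (hφ t ht').mono_left (nhdsWithin_le_of_mem hsub)
    exact (h4.eventually (lt_mem_nhds (by linarith [Real.pi_pos]))).and
      (h4.eventually (gt_mem_nhds (by linarith [Real.pi_pos])))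
  filter_upwards [h2, h3] with s hs hs'
  have hsQ : w s ∈ Q := hwQ ⟨(le_max_left _ _).trans hs.1, hs.2.le.trans ht.2⟩
  have h4 := hsin_pos _ hsQ (by rw [← hre]; exact hbef s ((le_max_right _ _).trans hs.1) hs.2)
  by_contra! h5
  rw [← sub_add_cancel (Λ (w s)).im ((2 * k + 1) * Real.pi), sin_add_odd_mul_pi] at h4
  have := Real.sin_nonneg_of_nonneg_of_le_pi (sub_nonneg.2 h5) (by linarith)
  linarith

theorem not_recurrent_of_injOn {w : ℝ → ℂ} {r c : ℝ} (hr : 0 < r) (hc : 0 < c)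
    (hw : ContinuousOn w (Set.Ioi 0)) (hinj : Set.InjOn w (Set.Ioi 0))
    (hrec : ∀ s > 0, ∀ T, ∀ ε > 0, ∃ t > T, dist (w t) (w s) < ε) (h1 : w 1 = 0)
    (hmono : IncreasesNearZero w r c)
    (hunif : ∀ ρ > 0, ∃ ε > 0, ∀ T > 0, ‖w T‖ < ε → ∀ τ ∈ Set.Icc 0 ε, ‖w (T + τ)‖ < ρ) :
    False := by
  obtain ⟨ε₁, hε₁, hbefore1, hafter1⟩ := hmono.exists_ball hc hw one_pos (by simpa [h1] using hr)
  have hw1re : (w 1).re = 0 := by simp [h1]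
  rw [hw1re] at hbefore1 hafter1
  obtain ⟨ε, hε, hunif⟩ := hunif (r / 2) (half_pos hr)
  set κ := min ε (c * ε) with hκ
  have hκ0 : 0 < κ := lt_min hε (mul_pos hc hε)
  obtain ⟨s₀, hs₀, hs₀δ, hs₀re⟩ : ∃ s₀ > 0, ‖w s₀‖ < κ / 2 ∧ (w s₀).re < 0 := by
    have h2 : ∀ᶠ s in 𝓝[<] (1 : ℝ), ‖w s‖ < κ / 2 := by
      have := (hw.continuousAt (Ioi_mem_nhds one_pos)).eventually
        (Metric.ball_mem_nhds _ (half_pos hκ0))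
      filter_upwards [nhdsWithin_le_nhds this] with s hs
      simpa [h1] using hs
    have h3 : ∀ᶠ s in 𝓝[<] (1 : ℝ), s ∈ Set.Ico (1 - ε₁) 1 := Ico_mem_nhdsLT (by linarith)
    have h4 : ∀ᶠ s in 𝓝[<] (1 : ℝ), s ∈ Set.Ico (0.5 : ℝ) 1 := Ico_mem_nhdsLT (by norm_num)
    obtain ⟨s, hs2, hs3, hs4⟩ := (h2.and (h3.and h4)).exists
    exact ⟨s, by norm_num at hs4; linarith [hs4.1], hs2, hbefore1 s hs3.1 hs3.2⟩
  obtain ⟨T, hT, hTs₀⟩ := hrec s₀ hs₀ (1 + ε₁) (min (κ / 2) (-(w s₀).re))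
    (lt_min (half_pos hκ0) (by linarith))
  rw [dist_eq_norm, lt_min_iff] at hTs₀
  have hTre : (w T).re < 0 := by
    have := (Complex.abs_re_le_norm (w T - w s₀)).trans_lt hTs₀.2
    rw [Complex.sub_re, abs_lt] at this
    linarith
  have hTκ : ‖w T‖ < κ := by
    calc ‖w T‖ = ‖(w T - w s₀) + w s₀‖ := by simp
      _ ≤ _ := norm_add_le _ _
      _ < κ := by linarith
  have hT0 : 0 < T := by linarith
  have hstay : ∀ t ∈ Set.Icc T (T + ε), ‖w t‖ < r / 2 := by
    intro t ht
    have := hunif T hT0 (hTκ.trans_le (min_le_left _ _)) (t - T)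
      ⟨by linarith [ht.1], by linarith [ht.2]⟩
    rwa [add_sub_cancel] at this
  have hinc := hmono T (T + ε) hT0 (by linarith) fun τ hτ => (hstay τ hτ).trans (by linarith)
  have hend : 0 ≤ (w (T + ε)).re := by
    have h2 := (abs_le.1 (Complex.abs_re_le_norm (w T))).1
    have h3 := hTκ.trans_le (min_le_right _ _)
    rw [add_sub_cancel_left] at hinc
    linarith
  have hre : ContinuousOn (fun t => (w t).re) (Set.Ioi 0) :=
    Complex.continuous_re.comp_continuousOn hw
  obtain ⟨t', ht', ht're⟩ := intermediate_value_Icc (by linarith : T ≤ T + ε)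
    (hre.mono fun x hx => Set.mem_Ioi.2 (hT0.trans_le hx.1)) ⟨hTre.le, hend⟩
  have hsub : Set.Icc (1 + ε₁) t' ⊆ Set.Ioi 0 := fun x hx =>
    Set.mem_Ioi.2 (by linarith [hx.1])
  set S := Set.Icc (1 + ε₁) t' ∩ w ⁻¹' {z | z.re = 0 ∧ ‖z‖ ≤ r / 2} with hS
  have hSc : IsCompact S := isCompact_Icc.of_isClosed_subset
    ((hw.mono hsub).preimage_isClosed_of_isClosed isClosed_Icc
      ((isClosed_eq Complex.continuous_re continuous_const).inter
        (isClosed_le continuous_norm continuous_const))) Set.inter_subset_left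
  obtain ⟨t₁, ⟨ht₁, ht₁re, ht₁n⟩, hmin⟩ := hSc.exists_isMinOn
    ⟨t', ⟨by linarith [ht'.1], le_rfl⟩, ht're, (hstay t' ht').le⟩ continuousOn_id
  have ht₁1 : 1 < t₁ := by linarith [ht₁.1]
  have hfirst : ∀ t ∈ Set.Ioo 1 t₁, (w t).re = 0 → r / 2 < |(w t).im| := by
    intro t ht h0
    rcases le_total t (1 + ε₁) with h | h
    · exact absurd h0 (hafter1 t ht.1 h).ne'
    · by_contra! h2
      have : t₁ ≤ t := hmin ⟨⟨h, by linarith [ht₁.2, ht.2]⟩, h0, by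
        rw [← Complex.re_add_im (w t), h0]; simpa using h2⟩
      linarith [ht.2]
  have hwt₁ : w t₁ = (w t₁).im * Complex.I := by
    conv_lhs => rw [← Complex.re_add_im (w t₁), ht₁re]
    simp
  have him : |(w t₁).im| ≤ r / 2 := (Complex.abs_im_le_norm _).trans ht₁n
  have him0 : (w t₁).im ≠ 0 := by
    intro h
    rw [h, Complex.ofReal_zero, zero_mul, ← h1] at hwt₁
    have := hinj (Set.mem_Ioi.2 (by linarith)) (Set.mem_Ioi.2 one_pos) hwt₁
    linarith
  rcases him0.lt_or_gt with hneg | hpos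
  · rw [abs_of_neg hneg] at him
    refine not_recurrent_of_first_return (w := fun t => (starRingEnd ℂ) (w t)) (β := -(w t₁).im)
      (t₁ := t₁) (r := r) hc (Complex.continuous_conj.comp_continuousOn hw)
      (fun a ha b hb h => hinj ha hb ((starRingEnd ℂ).injective h)) ?_ (by simp [h1]) ?_ ht₁1
      (by linarith) (by linarith) ?_ ?_
    · intro s hs T ε hε
      obtain ⟨t, ht, h⟩ := hrec s hs T ε hε
      exact ⟨t, ht, by rwa [Complex.dist_conj_conj]⟩
    · intro s t hs hst h
      simpa using hmono s t hs hst (by simpa using h)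
    · rw [hwt₁]; simp
    · intro t ht h0 h2
      have := hfirst t ht (by simpa using h0)
      rw [Complex.conj_im] at h2 ⊢
      rw [abs_of_nonpos (by linarith)] at this
      linarith
  · rw [abs_of_pos hpos] at him
    refine not_recurrent_of_first_return hc hw hinj hrec h1 hmono ht₁1 hpos (by linarith) hwt₁ ?_
    intro t ht h0 h2
    have := hfirst t ht h0
    rw [abs_of_nonneg h2] at this
    linarith

section Recurrence

variable {X : Type*} [TopologicalSpace X]

/-- The ω-limit set of the orbit of `x` under the semiflow `σ`. -/
def orbitLimitSet (σ : ℝ≥0 → X → X) (x : X) : Set X :=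
  ⋂ T : ℝ≥0, closure ((fun t => σ t x) '' Set.Ici T)

theorem isClosed_orbitLimitSet (σ : ℝ≥0 → X → X) (x : X) : IsClosed (orbitLimitSet σ x) :=
  isClosed_iInter fun _ => isClosed_closure

theorem nonempty_orbitLimitSet [CompactSpace X] (σ : ℝ≥0 → X → X) (x : X) :
    (orbitLimitSet σ x).Nonempty := by
  refine IsCompact.nonempty_iInter_of_directed_nonempty_isCompact_isClosed _ ?_ ?_
    (fun _ => isClosed_closure.isCompact) fun _ => isClosed_closure
  · intro S T
    exact ⟨max S T, closure_mono (Set.image_mono (Set.Ici_subset_Ici.2 (le_max_left _ _))),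
      closure_mono (Set.image_mono (Set.Ici_subset_Ici.2 (le_max_right _ _)))⟩
  · exact fun T => ⟨σ T x, subset_closure ⟨T, Set.self_mem_Ici, rfl⟩⟩

theorem mapsTo_orbitLimitSet {σ : ℝ≥0 → X → X} (hσ : ∀ t, Continuous (σ t))
    (hadd : ∀ s t x, σ (s + t) x = σ s (σ t x)) (x : X) (s : ℝ≥0) :
    Set.MapsTo (σ s) (orbitLimitSet σ x) (orbitLimitSet σ x) := by
  intro z hz
  refine Set.mem_iInter.2 fun T => ?_
  refine map_mem_closure (hσ s) (Set.mem_iInter.1 hz T) ?_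
  rintro _ ⟨t, ht, rfl⟩
  exact ⟨s + t, Set.mem_Ici.2 (le_add_of_nonneg_of_le zero_le ht), hadd s t x⟩

theorem orbitLimitSet_subset {σ : ℝ≥0 → X → X} {A : Set X} (hA : IsClosed A)
    (hinv : ∀ t, Set.MapsTo (σ t) A A) {x : X} (hx : x ∈ A) : orbitLimitSet σ x ⊆ A := by
  refine (Set.iInter_subset _ 0).trans (closure_minimal ?_ hA)
  rintro _ ⟨t, -, rfl⟩
  exact hinv t hx

theorem exists_mem_orbitLimitSet_self [CompactSpace X] {σ : ℝ≥0 → X → X}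
    (hσ : ∀ t, Continuous (σ t)) (hadd : ∀ s t x, σ (s + t) x = σ s (σ t x)) {Ω : Set X}
    (hΩ : IsClosed Ω) (hne : Ω.Nonempty) (hinv : ∀ t, Set.MapsTo (σ t) Ω Ω) :
    ∃ y ∈ Ω, ∀ s, σ s y ∈ orbitLimitSet σ y := by
  obtain ⟨m, hmΩ, ⟨hmc, hmne, hminv⟩, hmin⟩ := zorn_superset_nonempty
    {A : Set X | IsClosed A ∧ A.Nonempty ∧ ∀ t, Set.MapsTo (σ t) A A}
    (fun c hc hchain hcne => by
      refine ⟨⋂₀ c, ⟨isClosed_sInter fun A hA => (hc hA).1, ?_, ?_⟩,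
        fun A hA => Set.sInter_subset_of_mem hA⟩
      · have := hcne.to_subtype
        exact IsCompact.nonempty_sInter_of_directed_nonempty_isCompact_isClosed
          (fun A hA B hB => (hchain.total hA hB).elim
            (fun h => ⟨A, hA, subset_rfl, h⟩) fun h => ⟨B, hB, h, subset_rfl⟩) (fun A hA => (hc hA).2.1)
          (fun A hA => (hc hA).1.isCompact) fun A hA => (hc hA).1
      · intro t z hz A hA
        exact (hc hA).2.2 t (hz A hA))
    Ω ⟨hΩ, hne, hinv⟩
  obtain ⟨y, hy⟩ := hmne
  have hle := hmin (y := orbitLimitSet σ y)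
    ⟨isClosed_orbitLimitSet σ y, nonempty_orbitLimitSet σ y, mapsTo_orbitLimitSet hσ hadd y⟩
    (orbitLimitSet_subset hmc hminv hy)
  exact ⟨y, hmΩ hy, fun s => hle (hminv s hy)⟩

end Recurrence

section Trajectory

variable {F : Type*} [NormedAddCommGroup F] [NormedSpace ℝ F] {Z : Set F} {N : ℕ}

/-- Trajectories of the switched system `Ψ`, described without integrals through the accumulated
switching times `U i t = ∫₀ᵗ uᵢ`. The function `δ` is a modulus for the first-order
approximation. -/
structure IsSwitchedTrajectory (Ψ : Fin N → Z → F) (δ : ℝ → ℝ) (y : ℝ≥0 → Z)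
    (U : ℝ≥0 → Fin N → ℝ) : Prop where
  mono : ∀ s t, s ≤ t → ∀ i, U s i ≤ U t i
  sum_eq : ∀ t : ℝ≥0, ∑ i, U t i = t
  zero : ∀ i, U 0 i = 0
  approx : ∀ ε > 0, ∀ s t : ℝ≥0, s ≤ t → (t : ℝ) - s ≤ δ ε →
    ‖(y t : F) - y s - ∑ i, (U t i - U s i) • Ψ i (y s)‖ ≤ ε * (t - s)

theorem IsSwitchedTrajectory.shift {Ψ : Fin N → Z → F} {δ : ℝ → ℝ} {y : ℝ≥0 → Z}
    {U : ℝ≥0 → Fin N → ℝ} (h : IsSwitchedTrajectory Ψ δ y U) (r : ℝ≥0) :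
    IsSwitchedTrajectory Ψ δ (fun t => y (r + t)) (fun t i => U (r + t) i - U r i) where
  mono s t hst i := by have := h.mono (r + s) (r + t) (by gcongr) i; linarith
  sum_eq t := by rw [Finset.sum_sub_distrib, h.sum_eq, h.sum_eq]; push_cast; ring
  zero i := by simp
  approx ε hε s t hst hδ := by
    have := h.approx ε hε (r + s) (r + t) (by gcongr) (by push_cast; linarith)
    push_cast at this
    simpa using this

theorem IsSwitchedTrajectory.sub_nonneg {Ψ : Fin N → Z → F} {δ : ℝ → ℝ} {y : ℝ≥0 → Z}
    {U : ℝ≥0 → Fin N → ℝ} (h : IsSwitchedTrajectory Ψ δ y U) {s t : ℝ≥0} (hst : s ≤ t)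
    (i : Fin N) : 0 ≤ U t i - U s i := by linarith [h.mono s t hst i]

theorem IsSwitchedTrajectory.sum_sub {Ψ : Fin N → Z → F} {δ : ℝ → ℝ} {y : ℝ≥0 → Z}
    {U : ℝ≥0 → Fin N → ℝ} (h : IsSwitchedTrajectory Ψ δ y U) (s t : ℝ≥0) :
    ∑ i, (U t i - U s i) = t - s := by
  rw [Finset.sum_sub_distrib, h.sum_eq, h.sum_eq]

theorem IsSwitchedTrajectory.sub_le {Ψ : Fin N → Z → F} {δ : ℝ → ℝ} {y : ℝ≥0 → Z}
    {U : ℝ≥0 → Fin N → ℝ} (h : IsSwitchedTrajectory Ψ δ y U) {s t : ℝ≥0} (hst : s ≤ t)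
    (i : Fin N) : U t i - U s i ≤ t - s := by
  rw [← h.sum_sub s t]
  exact Finset.single_le_sum (f := fun i => U t i - U s i) (fun j _ => h.sub_nonneg hst j)
    (Finset.mem_univ i)

theorem isClosed_setOf_exists_isSwitchedTrajectory [CompactSpace Z] {Ψ : Fin N → Z → F}
    (hΨ : ∀ i, Continuous (Ψ i)) (δ : ℝ → ℝ) :
    IsClosed {y : ℝ≥0 → Z | ∃ U, IsSwitchedTrajectory Ψ δ y U} := by
  set S : Set ((ℝ≥0 → Z) × (ℝ≥0 → Fin N → ℝ)) := {p | IsSwitchedTrajectory Ψ δ p.1 p.2} with hS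
  have hSc : IsClosed S := by
    have hUc : ∀ t i, Continuous fun p : (ℝ≥0 → Z) × (ℝ≥0 → Fin N → ℝ) => p.2 t i :=
      fun t i => by fun_prop
    have hyc : ∀ t, Continuous fun p : (ℝ≥0 → Z) × (ℝ≥0 → Fin N → ℝ) => p.1 t :=
      fun t => by fun_prop
    have heq : S = {p | ∀ s t, s ≤ t → ∀ i, p.2 s i ≤ p.2 t i} ∩
        ({p | ∀ t : ℝ≥0, ∑ i, p.2 t i = (t : ℝ)} ∩ ({p | ∀ i, p.2 0 i = 0} ∩
        {p | ∀ ε > 0, ∀ s t : ℝ≥0, s ≤ t → (t : ℝ) - s ≤ δ ε →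
          ‖(p.1 t : F) - p.1 s - ∑ i, (p.2 t i - p.2 s i) • Ψ i (p.1 s)‖ ≤ ε * (t - s)})) := by
      ext p
      exact ⟨fun h => ⟨h.1, h.2, h.3, h.4⟩, fun h => ⟨h.1, h.2.1, h.2.2.1, h.2.2.2⟩⟩
    rw [heq]
    refine .inter ?_ (.inter ?_ (.inter ?_ ?_))
    · simp only [Set.ofPred_forall]
      exact isClosed_iInter fun s => isClosed_iInter fun t => isClosed_iInter fun _ =>
        isClosed_iInter fun i => isClosed_le (hUc s i) (hUc t i)
    · simp only [Set.ofPred_forall]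
      exact isClosed_iInter fun t =>
        isClosed_eq (continuous_finsetSum _ fun i _ => hUc t i) continuous_const
    · simp only [Set.ofPred_forall]
      exact isClosed_iInter fun i => isClosed_eq (hUc 0 i) continuous_const
    · simp only [Set.ofPred_forall]
      refine isClosed_iInter fun ε => isClosed_iInter fun _ => isClosed_iInter fun s =>
        isClosed_iInter fun t => isClosed_iInter fun _ => isClosed_iInter fun _ =>
        isClosed_le (continuous_norm.comp ?_) continuous_const
      exact ((continuous_subtype_val.comp (hyc t)).sub (continuous_subtype_val.comp (hyc s))).sub
        (continuous_finsetSum _ fun i _ =>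
          ((hUc t i).sub (hUc s i)).smul ((hΨ i).comp (hyc s)))
  have hSK : IsCompact S := by
    refine IsCompact.of_isClosed_subset
      (isCompact_univ.prod (isCompact_univ_pi fun t : ℝ≥0 =>
        isCompact_univ_pi fun _ : Fin N => isCompact_Icc (a := (0 : ℝ)) (b := t))) hSc ?_
    rintro ⟨y, U⟩ h
    refine ⟨trivial, fun t _ i _ => ?_⟩
    have h1 := h.sub_nonneg (zero_le (a := t)) i
    have h2 := h.sub_le (zero_le (a := t)) i
    have h0 : U 0 i = 0 := h.zero i
    simp only [h0, sub_zero, NNReal.coe_zero] at h1 h2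
    exact ⟨h1, h2⟩
  convert (hSK.image continuous_fst).isClosed using 1
  ext y
  simp [hS]

theorem exists_recurrent_isSwitchedTrajectory [CompactSpace Z] {Ψ : Fin N → Z → F}
    (hΨ : ∀ i, Continuous (Ψ i)) {δ : ℝ → ℝ} {x : ℝ≥0 → Z}
    (hx : ∃ U, IsSwitchedTrajectory Ψ δ x U) :
    ∃ y U, IsSwitchedTrajectory Ψ δ y U ∧
      (∀ t, (y t : F) ∈ ⋂ T : ℝ≥0, closure ((fun r : ℝ≥0 => (x r : F)) '' Set.Ici T)) ∧
      ∀ s T, ∀ ε > 0, ∃ t ≥ T, dist (y t : F) (y s) < ε := by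
  set σ : ℝ≥0 → (ℝ≥0 → Z) → (ℝ≥0 → Z) := fun s y t => y (s + t) with hσdef
  have hσ : ∀ t, Continuous (σ t) := fun t => by fun_prop
  have hadd : ∀ s t x, σ (s + t) x = σ s (σ t x) := by
    intro s t x
    funext r
    simp only [hσdef]
    congr 1
    ring
  have hval : ∀ (z : ℝ≥0 → Z) (y : ℝ≥0 → Z) (t T : ℝ≥0), y ∈ orbitLimitSet σ z →
      (y t : F) ∈ closure ((fun r : ℝ≥0 => (z r : F)) '' Set.Ici T) := by
    intro z y t T hy
    refine map_mem_closure (f := fun y : ℝ≥0 → Z => (y t : F))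
      (continuous_subtype_val.comp (continuous_apply t)) (Set.mem_iInter.1 hy T) ?_
    rintro _ ⟨s, hs, rfl⟩
    exact ⟨s + t, Set.mem_Ici.2 (le_add_of_le_of_nonneg hs zero_le), rfl⟩
  obtain ⟨y, hy, hrec⟩ := exists_mem_orbitLimitSet_self hσ hadd (isClosed_orbitLimitSet σ x)
    (nonempty_orbitLimitSet σ x) (mapsTo_orbitLimitSet hσ hadd x)
  obtain ⟨U, hU⟩ := orbitLimitSet_subset (σ := σ)
    (isClosed_setOf_exists_isSwitchedTrajectory hΨ δ)
    (fun t y ⟨U, hU⟩ => ⟨_, hU.shift t⟩) hx hy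
  refine ⟨y, U, hU, fun t => Set.mem_iInter.2 fun T => hval x y t T hy, fun s T ε hε => ?_⟩
  have h := hval y (σ s y) 0 T (hrec s)
  simp only [hσdef, add_zero] at h
  obtain ⟨_, ⟨t, ht, rfl⟩, h2⟩ := Metric.mem_closure_iff.1 h ε hε
  exact ⟨t, ht, by rwa [dist_comm]⟩

end Trajectory

section Integral

variable {N : ℕ}

/-- A switching law that takes values in the standard simplex at every time. -/
structure IsSimplexLaw (v : Fin N → ℝ → ℝ) : Prop where
  measurable : ∀ i, Measurable (v i)
  nonneg : ∀ i s, 0 ≤ v i s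
  sum_eq_one : ∀ s, ∑ i, v i s = 1

theorem IsSimplexLaw.le_one {v : Fin N → ℝ → ℝ} (hv : IsSimplexLaw v) (i : Fin N) (s : ℝ) :
    v i s ≤ 1 := by
  rw [← hv.sum_eq_one s]
  exact Finset.single_le_sum (f := fun i => v i s) (fun j _ => hv.nonneg j s) (Finset.mem_univ i)

theorem IsSimplexLaw.isSwitchingLaw {v : Fin N → ℝ → ℝ} (hv : IsSimplexLaw v) :
    IsSwitchingLaw v :=
  ⟨hv.measurable, ae_of_all _ fun s => ⟨fun i => ⟨hv.nonneg i s, hv.le_one i s⟩, hv.sum_eq_one s⟩⟩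

theorem IsSwitchingLaw.exists_isSimplexLaw {u : Fin N → ℝ → ℝ} (hu : IsSwitchingLaw u) :
    ∃ v : Fin N → ℝ → ℝ, IsSimplexLaw v ∧
      ∀ᵐ s ∂(volume.restrict (Set.Ici (0 : ℝ))), ∀ i, v i s = u i s := by
  classical
  obtain ⟨hm, hae⟩ := hu
  have : (ae (volume.restrict (Set.Ici (0 : ℝ)))).NeBot := by
    rw [ae_neBot, Ne, Measure.restrict_eq_zero]
    simp
  obtain ⟨s₀, -, hs₀⟩ := hae.exists
  obtain ⟨i₀⟩ : Nonempty (Fin N) := by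
    by_contra h
    rw [not_nonempty_iff] at h
    simp at hs₀
  set A : Set ℝ := {s | (∀ i, u i s ∈ Set.Icc (0 : ℝ) 1) ∧ ∑ i, u i s = 1} with hA
  have hAm : MeasurableSet A := by
    have h1 : A = (⋂ i, u i ⁻¹' Set.Icc 0 1) ∩ (fun s => ∑ i, u i s) ⁻¹' {1} := by
      ext s; simp [hA]
    rw [h1]
    exact (MeasurableSet.iInter fun i => hm i measurableSet_Icc).inter
      ((Finset.measurable_sum _ fun i _ => hm i) (measurableSet_singleton 1))
  refine ⟨fun i s => if s ∈ A then u i s else if i = i₀ then 1 else 0, ⟨fun i => ?_, ?_, ?_⟩, ?_⟩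
  · exact (hm i).ite hAm measurable_const
  · intro i s
    split_ifs with h
    · exact (h.1 i).1
    · exact zero_le_one
    · exact le_rfl
  · intro s
    split_ifs with h
    · exact h.2
    · simp
  · filter_upwards [hae] with s hs i
    exact if_pos hs

theorem intervalIntegrable_of_norm_le {F : Type*} [NormedAddCommGroup F] {f : ℝ → F} 
    (hf : StronglyMeasurable f) {B : ℝ}
    (hB : ∀ s, ‖f s‖ ≤ B) (a b : ℝ) : IntervalIntegrable f volume a b :=
  (intervalIntegrable_const (c := B)).mono_fun hf.aestronglyMeasurable
    (ae_of_all _ fun s => (hB s).trans (le_abs_self B))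

variable {F : Type*} [NormedAddCommGroup F] [NormedSpace ℝ F]

theorem IsSimplexLaw.norm_sum_smul_le {v : Fin N → ℝ → ℝ} (hv : IsSimplexLaw v) {p : Fin N → F}
    {ε : ℝ} (hp : ∀ i, ‖p i‖ ≤ ε) (s : ℝ) : ‖∑ i, v i s • p i‖ ≤ ε := by
  calc ‖∑ i, v i s • p i‖ ≤ ∑ i, ‖v i s • p i‖ := norm_sum_le _ _
    _ ≤ ∑ i, v i s * ε := by
        gcongr with i
        rw [norm_smul, Real.norm_eq_abs, abs_of_nonneg (hv.nonneg i s)]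
        exact mul_le_mul_of_nonneg_left (hp i) (hv.nonneg i s)
    _ = ε := by rw [← Finset.sum_mul, hv.sum_eq_one, one_mul]

theorem IsSimplexLaw.intervalIntegrable {v : Fin N → ℝ → ℝ} (hv : IsSimplexLaw v) (i : Fin N)
    (a b : ℝ) : IntervalIntegrable (v i) volume a b :=
  intervalIntegrable_of_norm_le (hv.measurable i).stronglyMeasurable (B := 1)
    (fun s => by rw [Real.norm_eq_abs, abs_of_nonneg (hv.nonneg i s)]; exact hv.le_one i s) a b

theorem IsSimplexLaw.stronglyMeasurable_sum_smul {v : Fin N → ℝ → ℝ} (hv : IsSimplexLaw v)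
    {p : Fin N → ℝ → F} (hp : ∀ i, Continuous (p i)) :
    StronglyMeasurable fun s => ∑ i, v i s • p i s :=
  Finset.stronglyMeasurable_fun_sum _ fun i _ =>
    (hv.measurable i).stronglyMeasurable.smul (hp i).stronglyMeasurable

theorem IsSimplexLaw.intervalIntegrable_sum_smul {v : Fin N → ℝ → ℝ} (hv : IsSimplexLaw v)
    {p : Fin N → ℝ → F} (hp : ∀ i, Continuous (p i)) (a b : ℝ) :
    IntervalIntegrable (fun s => ∑ i, v i s • p i s) volume a b := by
  have h := IntervalIntegrable.sum Finset.univ (μ := volume) (a := a) (b := b)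
    (f := fun i s => v i s • p i s)
    fun i _ => (hv.intervalIntegrable i a b).smul_continuousOn (hp i).continuousOn
  simpa only [Finset.sum_fn] using h

theorem IsSimplexLaw.norm_integral_sub_sum_le [CompleteSpace F] {v : Fin N → ℝ → ℝ}
    (hv : IsSimplexLaw v)
    {p : Fin N → ℝ → F} (hp : ∀ i, Continuous (p i)) {a b ε : ℝ} (hab : a ≤ b)
    (hε : ∀ s ∈ Set.Icc a b, ∀ i, ‖p i s - p i a‖ ≤ ε) :
    ‖(∫ s in a..b, ∑ i, v i s • p i s) - ∑ i, (∫ s in a..b, v i s) • p i a‖ ≤ ε * (b - a) := by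
  have h1 : ∑ i, (∫ s in a..b, v i s) • p i a = ∫ s in a..b, ∑ i, v i s • p i a := by
    rw [intervalIntegral.integral_finsetSum]
    · simp only [intervalIntegral.integral_smul_const]
    · exact fun i _ => (hv.intervalIntegrable i a b).smul_continuousOn continuousOn_const
  rw [h1, ← intervalIntegral.integral_sub (hv.intervalIntegrable_sum_smul hp a b)
    (hv.intervalIntegrable_sum_smul (fun i => continuous_const) a b)]
  simp only [← Finset.sum_sub_distrib, ← smul_sub]
  have h2 := intervalIntegral.norm_integral_le_of_norm_le_const (a := a) (b := b) (C := ε)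
    (f := fun s => ∑ i, v i s • (p i s - p i a)) fun s hs => by
      rw [Set.uIoc_of_le hab] at hs
      exact hv.norm_sum_smul_le (hε s ⟨hs.1.le, hs.2⟩) s
  rwa [abs_of_nonneg (by linarith)] at h2

end Integral

section IntegralTrajectory

variable {N : ℕ} {F : Type*} [NormedAddCommGroup F] {Z : Set F}

theorem exists_norm_le_of_continuous [CompactSpace Z] {Ψ : Fin N → Z → F}
    (hΨ : ∀ i, Continuous (Ψ i)) : ∃ B, 0 < B ∧ ∀ i z, ‖Ψ i z‖ ≤ B := by
  have hc : Continuous fun z i => Ψ i z := continuous_pi hΨ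
  obtain ⟨B, hB⟩ := (isCompact_range hc).isBounded.exists_norm_le
  refine ⟨max B 1, by positivity, fun i z => le_max_of_le_left ?_⟩
  exact (norm_le_pi_norm (fun i => Ψ i z) i).trans (hB _ ⟨z, rfl⟩)

theorem exists_modulus_of_continuous [CompactSpace Z] {Ψ : Fin N → Z → F}
    (hΨ : ∀ i, Continuous (Ψ i)) :
    ∃ η : ℝ → ℝ, (∀ ε > 0, 0 < η ε) ∧
      ∀ ε > 0, ∀ z z' : Z, ‖(z : F) - z'‖ < η ε → ∀ i, ‖Ψ i z - Ψ i z'‖ ≤ ε := by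
  have hc : Continuous fun z i => Ψ i z := continuous_pi hΨ
  have hu := Metric.uniformContinuous_iff.1 (CompactSpace.uniformContinuous_of_continuous hc)
  choose! η hη using hu
  refine ⟨η, fun ε hε => (hη ε hε).1, fun ε hε z z' h i => ?_⟩
  have h1 := @(hη ε hε).2 z z' (by rwa [Subtype.dist_eq, dist_eq_norm])
  rw [← dist_eq_norm]
  exact (dist_le_pi_dist _ _ i).trans h1.le

variable [NormedSpace ℝ F]

theorem IsSimplexLaw.exists_isSwitchedTrajectory [CompleteSpace F] [CompactSpace Z]
    {Ψ : Fin N → Z → F} (hΨ : ∀ i, Continuous (Ψ i)) {v : Fin N → ℝ → ℝ} (hv : IsSimplexLaw v)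
    {x : ℝ≥0 → Z} (hxc : Continuous x)
    (hx : ∀ t : ℝ≥0, (x t : F) = x 0 + ∫ s in (0 : ℝ)..t, ∑ i, v i s • Ψ i (x s.toNNReal)) :
    ∃ δ U, (∀ ε > 0, 0 < δ ε) ∧ IsSwitchedTrajectory Ψ δ x U := by
  obtain ⟨B, hB0, hB⟩ := exists_norm_le_of_continuous hΨ
  obtain ⟨η, hη0, hη⟩ := exists_modulus_of_continuous hΨ
  have hp : ∀ i, Continuous fun s : ℝ => Ψ i (x s.toNNReal) := fun i =>
    (hΨ i).comp (hxc.comp continuous_real_toNNReal)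
  have hint := hv.intervalIntegrable_sum_smul hp
  have hsub : ∀ s t : ℝ≥0, (x t : F) - x s = ∫ r in (s : ℝ)..t, ∑ i, v i r • Ψ i (x r.toNNReal) := by
    intro s t
    rw [hx t, hx s, add_sub_add_left_eq_sub,
      intervalIntegral.integral_interval_sub_left (hint _ _) (hint _ _)]
  have hlip : ∀ s t : ℝ≥0, s ≤ t → ‖(x t : F) - x s‖ ≤ B * (t - s) := by
    intro s t hst
    rw [hsub]
    have h := intervalIntegral.norm_integral_le_of_norm_le_const (a := (s : ℝ)) (b := t) (C := B)
      (f := fun r => ∑ i, v i r • Ψ i (x r.toNNReal)) fun r _ =>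
        hv.norm_sum_smul_le (fun i => hB i _) r
    rwa [abs_of_nonneg (sub_nonneg.2 (NNReal.coe_le_coe.2 hst))] at h
  refine ⟨fun ε => η ε / (2 * B), fun t i => ∫ s in (0 : ℝ)..t, v i s,
    fun ε hε => div_pos (hη0 ε hε) (by positivity), ?_, ?_, ?_, ?_⟩
  · intro s t hst i
    rw [← sub_nonneg, intervalIntegral.integral_interval_sub_left (hv.intervalIntegrable i _ _)
      (hv.intervalIntegrable i _ _)]
    exact intervalIntegral.integral_nonneg (NNReal.coe_le_coe.2 hst) fun r _ => hv.nonneg i r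
  · intro t
    rw [← intervalIntegral.integral_finsetSum fun i _ => hv.intervalIntegrable i _ _]
    simp [hv.sum_eq_one]
  · simp
  · intro ε hε s t hst hδ
    have hst' := NNReal.coe_le_coe.2 hst
    simp only [hsub s t]
    have h := hv.norm_integral_sub_sum_le hp (ε := ε) hst' ?_
    · convert h using 4 with i
      rw [intervalIntegral.integral_interval_sub_left (hv.intervalIntegrable i _ _)
        (hv.intervalIntegrable i _ _), Real.toNNReal_coe]
    · intro r hr i
      refine hη ε hε _ _ ?_ i
      have hr0 : 0 ≤ r := s.coe_nonneg.trans hr.1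
      rw [Real.toNNReal_coe]
      have h1 := hlip s r.toNNReal (Real.le_toNNReal_iff_coe_le hr0 |>.2 hr.1)
      rw [Real.coe_toNNReal r hr0] at h1
      have h2 : (t : ℝ) - s < η ε / B :=
        hδ.trans_lt (div_lt_div_of_pos_left (hη0 ε hε) hB0 (by linarith))
      rw [lt_div_iff₀ hB0] at h2
      nlinarith [hr.2]

theorem IsSwitchedTrajectory.norm_sum_smul_le {Ψ : Fin N → Z → F} {δ : ℝ → ℝ} {y : ℝ≥0 → Z}
    {U : ℝ≥0 → Fin N → ℝ} (h : IsSwitchedTrajectory Ψ δ y U) {s t : ℝ≥0} (hst : s ≤ t)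
    {B : ℝ} {q : Fin N → F} (hq : ∀ i, ‖q i‖ ≤ B) :
    ‖∑ i, (U t i - U s i) • q i‖ ≤ B * (t - s) := by
  calc ‖∑ i, (U t i - U s i) • q i‖ ≤ ∑ i, ‖(U t i - U s i) • q i‖ := norm_sum_le _ _
    _ ≤ ∑ i, (U t i - U s i) * B := by
        gcongr with i
        rw [norm_smul, Real.norm_eq_abs, abs_of_nonneg (h.sub_nonneg hst i)]
        exact mul_le_mul_of_nonneg_left (hq i) (h.sub_nonneg hst i)
    _ = B * (t - s) := by rw [← Finset.sum_mul, h.sum_sub, mul_comm]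

theorem IsSwitchedTrajectory.norm_sub_le {Ψ : Fin N → Z → F} {δ : ℝ → ℝ} {y : ℝ≥0 → Z}
    {U : ℝ≥0 → Fin N → ℝ} (h : IsSwitchedTrajectory Ψ δ y U) {B : ℝ} (hB : ∀ i z, ‖Ψ i z‖ ≤ B)
    {s t : ℝ≥0} (hst : s ≤ t) (hδ : (t : ℝ) - s ≤ δ 1) :
    ‖(y t : F) - y s‖ ≤ (B + 1) * (t - s) := by
  have h1 := h.approx 1 one_pos s t hst hδ
  have h2 := h.norm_sum_smul_le hst fun i => hB i (y s)
  have h3 := norm_add_le ((y t : F) - y s - ∑ i, (U t i - U s i) • Ψ i (y s))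
    (∑ i, (U t i - U s i) • Ψ i (y s))
  rw [sub_add_cancel] at h3
  linarith

theorem IsSwitchedTrajectory.continuous [CompactSpace Z] {Ψ : Fin N → Z → F}
    (hΨ : ∀ i, Continuous (Ψ i)) {δ : ℝ → ℝ} (hδ : ∀ ε > 0, 0 < δ ε) {y : ℝ≥0 → Z}
    {U : ℝ≥0 → Fin N → ℝ} (h : IsSwitchedTrajectory Ψ δ y U) : Continuous y := by
  obtain ⟨B, hB0, hB⟩ := exists_norm_le_of_continuous hΨ
  have hd : ∀ s t : ℝ≥0, dist s t ≤ δ 1 → dist (y s) (y t) ≤ (B + 1) * dist s t := by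
    intro s t hst
    wlog hle : s ≤ t generalizing s t
    · have := this t s (by rwa [dist_comm]) (le_of_not_ge hle)
      rwa [dist_comm (y s), dist_comm s]
    have h1 : dist s t = (t : ℝ) - s := by
      rw [NNReal.dist_eq, abs_sub_comm,
        abs_of_nonneg (_root_.sub_nonneg.2 (NNReal.coe_le_coe.2 hle))]
    rw [Subtype.dist_eq, dist_comm, dist_eq_norm, h1]
    exact h.norm_sub_le hB hle (h1 ▸ hst)
  refine Metric.continuous_iff.2 fun t ε hε => ⟨min (δ 1) (ε / (B + 1)),
    lt_min (hδ 1 one_pos) (by positivity), fun s hs => ?_⟩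
  have h2 := hd s t (hs.le.trans (min_le_left _ _))
  have h3 := hs.trans_le (min_le_right _ _)
  rw [lt_div_iff₀ (by positivity)] at h3
  linarith

end IntegralTrajectory

section Recovery

variable {N : ℕ} {F : Type*} [NormedAddCommGroup F] [NormedSpace ℝ F] {Z : Set F}

theorem IsSwitchedTrajectory.exists_isSimplexLaw {Ψ : Fin N → Z → F} {δ : ℝ → ℝ} {y : ℝ≥0 → Z}
    {U : ℝ≥0 → Fin N → ℝ} (h : IsSwitchedTrajectory Ψ δ y U) :
    ∃ v : Fin N → ℝ → ℝ, IsSimplexLaw v ∧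
      ∀ s t : ℝ≥0, ∀ i, ∫ r in (s : ℝ)..t, v i r = U t i - U s i := by
  set V : Fin N → ℝ → ℝ := fun i r => U r.toNNReal i with hV
  have hlip : ∀ i, LipschitzWith 1 (V i) := by
    intro i
    have h1 : LipschitzWith 1 fun s => U s i := LipschitzWith.of_le_add fun s t => by
      rw [NNReal.dist_eq]
      rcases le_total s t with hst | hst
      · linarith [h.mono s t hst i, abs_nonneg ((s : ℝ) - t)]
      · linarith [h.sub_le hst i, le_abs_self ((s : ℝ) - t)]
    have h2 := h1.comp Real.lipschitzWith_toNNReal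
    rwa [mul_one] at h2
  have hmono : ∀ i, Monotone (V i) := fun i r s hrs => h.mono _ _ (Real.toNNReal_mono hrs) i
  have hu : IsSwitchingLaw fun i => deriv (V i) := by
    refine ⟨fun i => measurable_deriv _, ?_⟩
    have hd : ∀ᵐ s, ∀ i, DifferentiableAt ℝ (V i) s :=
      ae_all_iff.2 fun i => (hlip i).ae_differentiableAt_real
    have h0 : ∀ᵐ s : ℝ, s ≠ 0 := by simp [ae_iff]
    filter_upwards [ae_restrict_of_ae hd, ae_restrict_of_ae h0,
      ae_restrict_mem measurableSet_Ici] with s hs hs0 hs1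
    have hpos : 0 < s := lt_of_le_of_ne hs1 (Ne.symm hs0)
    have hsum : ∑ i, deriv (V i) s = 1 := by
      refine (HasDerivAt.fun_sum fun i _ => (hs i).hasDerivAt).unique
        ((hasDerivAt_id s).congr_of_eventuallyEq ?_)
      filter_upwards [Ioi_mem_nhds hpos] with r hr
      simp only [hV, h.sum_eq, Real.coe_toNNReal r (le_of_lt hr), id]
    refine ⟨fun i => ⟨(hmono i).deriv_nonneg, ?_⟩, hsum⟩
    rw [← hsum]
    exact Finset.single_le_sum (f := fun i => deriv (V i) s)
      (fun j _ => (hmono j).deriv_nonneg) (Finset.mem_univ i)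
  obtain ⟨v, hv, hvu⟩ := hu.exists_isSimplexLaw
  refine ⟨v, hv, fun s t i => ?_⟩
  have h2 := ((hlip i).lipschitzOnWith (s := Set.uIcc (s : ℝ) t)
    ).absolutelyContinuousOnInterval.integral_deriv_eq_sub
  simp only [hV, Real.toNNReal_coe] at h2
  rw [← h2]
  refine intervalIntegral.integral_congr_ae ?_
  rw [ae_restrict_iff' measurableSet_Ici] at hvu
  filter_upwards [hvu] with r hr hr'
  exact hr (le_of_lt (lt_of_le_of_lt (le_min s.coe_nonneg t.coe_nonneg) hr'.1)) i

theorem IsSwitchedTrajectory.exists_integral_eq [CompleteSpace F] [CompactSpace Z]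
    {Ψ : Fin N → Z → F}
    (hΨ : ∀ i, Continuous (Ψ i)) {δ : ℝ → ℝ} (hδ : ∀ ε > 0, 0 < δ ε) {y : ℝ≥0 → Z}
    {U : ℝ≥0 → Fin N → ℝ} (h : IsSwitchedTrajectory Ψ δ y U) :
    ∃ v : Fin N → ℝ → ℝ, IsSimplexLaw v ∧
      ∀ t : ℝ≥0, (y t : F) = y 0 + ∫ s in (0 : ℝ)..t, ∑ i, v i s • Ψ i (y s.toNNReal) := by
  have hyc := h.continuous hΨ hδ
  obtain ⟨v, hv, hvU⟩ := h.exists_isSimplexLaw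
  refine ⟨v, hv, fun t => ?_⟩
  have hp : ∀ i, Continuous fun s : ℝ => Ψ i (y s.toNNReal) := fun i =>
    (hΨ i).comp (hyc.comp continuous_real_toNNReal)
  have hint := hv.intervalIntegrable_sum_smul hp
  set G : ℝ → F := fun r =>
    (y r.toNNReal : F) - ∫ s in (0 : ℝ)..r, ∑ i, v i s • Ψ i (y s.toNNReal) with hG
  have hGc : Continuous G := (continuous_subtype_val.comp
    (hyc.comp continuous_real_toNNReal)).sub (intervalIntegral.continuous_primitive hint 0)
  have hGd : ∀ r ∈ Set.Ico (0 : ℝ) t, HasDerivWithinAt G 0 (Set.Ici r) r := by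
    intro r hr
    rw [hasDerivWithinAt_iff_isLittleO, Asymptotics.isLittleO_iff]
    intro ε hε
    have hnear : ∀ᶠ q in 𝓝 r, ∀ i, ‖Ψ i (y q.toNNReal) - Ψ i (y r.toNNReal)‖ < ε / 2 := by
      refine eventually_all.2 fun i => ?_
      have := Metric.tendsto_nhds.1 ((hp i).continuousAt (x := r)) (ε / 2) (half_pos hε)
      simpa only [dist_eq_norm] using this
    obtain ⟨ρ, hρ, hρ'⟩ := Metric.eventually_nhds_iff.1 hnear
    have hd := hδ (ε / 2) (half_pos hε)
    filter_upwards [inter_mem_nhdsWithin (Set.Ici r)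
      (Metric.ball_mem_nhds r (lt_min hρ hd))] with q hq
    obtain ⟨hq1, hq2⟩ := hq
    rw [Set.mem_Ici] at hq1
    have hq0 : 0 ≤ q := hr.1.trans hq1
    rw [Metric.mem_ball, Real.dist_eq, abs_of_nonneg (by linarith), lt_min_iff] at hq2
    have h1 := h.approx (ε / 2) (half_pos hε) r.toNNReal q.toNNReal (Real.toNNReal_mono hq1)
      (by rw [Real.coe_toNNReal _ hr.1, Real.coe_toNNReal _ hq0]; exact hq2.2.le)
    have h2 := hv.norm_integral_sub_sum_le hp hq1 (ε := ε / 2) fun s hs i => (hρ' (by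
      rw [Real.dist_eq, abs_of_nonneg (by linarith [hs.1])]
      linarith [hs.2]) i).le
    have h3 := hvU r.toNNReal q.toNNReal
    rw [Real.coe_toNNReal _ hr.1, Real.coe_toNNReal _ hq0] at h1 h3
    simp only [h3] at h2
    have h4 : G q - G r - (q - r) • (0 : F) =
        ((y q.toNNReal : F) - y r.toNNReal -
          ∑ i, (U q.toNNReal i - U r.toNNReal i) • Ψ i (y r.toNNReal)) -
        ((∫ s in r..q, ∑ i, v i s • Ψ i (y s.toNNReal)) -
          ∑ i, (U q.toNNReal i - U r.toNNReal i) • Ψ i (y r.toNNReal)) := by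
      rw [← intervalIntegral.integral_interval_sub_left (hint 0 q) (hint 0 r)]
      simp only [hG, smul_zero]
      abel
    rw [h4, Real.norm_eq_abs, abs_of_nonneg (by linarith)]
    refine (_root_.norm_sub_le _ _).trans ?_
    linarith
  have hconst := constant_of_has_deriv_right_zero hGc.continuousOn hGd t ⟨t.coe_nonneg, le_rfl⟩
  simp only [hG, Real.toNNReal_coe, Real.toNNReal_zero, intervalIntegral.integral_same,
    sub_zero] at hconst
  rw [← hconst, sub_add_cancel]

end Recovery

section Periodic

variable {N : ℕ} {F : Type*} [NormedAddCommGroup F] [NormedSpace ℝ F] {Z : Set F}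

theorem IsSimplexLaw.exists_periodic [CompleteSpace F] [CompactSpace Z]
    {Ψ : Fin N → Z → F} (hΨ : ∀ i, Continuous (Ψ i)) {v : Fin N → ℝ → ℝ} (hv : IsSimplexLaw v)
    {y : ℝ≥0 → Z} (hyc : Continuous y)
    (hy : ∀ t : ℝ≥0, (y t : F) = y 0 + ∫ s in (0 : ℝ)..t, ∑ i, v i s • Ψ i (y s.toNNReal))
    {p : ℝ≥0} (hp : 0 < p) (hyp : y p = y 0) :
    ∃ (Y : C(ℝ≥0, Z)) (V : Fin N → ℝ → ℝ), (∀ t, ∃ s, Y t = y s) ∧ (∀ t, Y (t + p) = Y t) ∧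
      IsSimplexLaw V ∧ (∀ i s, V i (s + p) = V i s) ∧
      ∀ t : ℝ≥0, (Y t : F) = Y 0 + ∫ s in (0 : ℝ)..t, ∑ i, V i s • Ψ i (Y s.toNNReal) := by
  obtain ⟨B, hB0, hB⟩ := exists_norm_le_of_continuous hΨ
  have hp' : (0 : ℝ) < p := NNReal.coe_pos.2 hp
  set m : ℝ → ℝ := fun s => Int.fract (s / p) * p with hm
  have hm0 : ∀ s, 0 ≤ m s := fun s => mul_nonneg (Int.fract_nonneg _) hp'.le
  have hmp : ∀ s, m s < p := fun s => by
    have := mul_lt_mul_of_pos_right (Int.fract_lt_one (s / p)) hp'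
    rwa [one_mul] at this
  have hmper : Function.Periodic m p := fun s => by
    simp only [hm]
    rw [add_div, div_self hp'.ne', Int.fract_add_one]
  have hmid : ∀ s : ℝ, 0 ≤ s → s < p → m s = s := fun s h0 h1 => by
    simp only [hm]
    rw [Int.fract_eq_self.2 ⟨div_nonneg h0 hp'.le, (div_lt_one hp').2 h1⟩,
      div_mul_cancel₀ _ hp'.ne']
  have hmsub : ∀ s, m s = s - ⌊s / p⌋ • (p : ℝ) := fun s => by
    simp only [hm, Int.fract, zsmul_eq_mul]
    field_simp
  have hmm : Measurable m := (measurable_fract.comp (measurable_id.div_const _)).mul_const _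
  set f : ℝ → F := fun s => ∑ i, v i s • Ψ i (y s.toNNReal) with hf
  have hfm : StronglyMeasurable fun s => f (m s) :=
    (hv.stronglyMeasurable_sum_smul fun i =>
      (hΨ i).comp (hyc.comp continuous_real_toNNReal)).comp_measurable hmm
  have hfint : ∀ a b, IntervalIntegrable (fun s => f (m s)) volume a b :=
    intervalIntegrable_of_norm_le hfm fun s => hv.norm_sum_smul_le (fun i => hB i _) (m s)
  have hcongr : ∀ r : ℝ, 0 ≤ r → r ≤ p → ∫ s in (0 : ℝ)..r, f (m s) = ∫ s in (0 : ℝ)..r, f s := by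
    intro r h0 h1
    refine intervalIntegral.integral_congr_ae ?_
    have hne : ∀ᵐ s : ℝ, s ≠ p := by simp [ae_iff]
    filter_upwards [hne] with s hs hs'
    rw [Set.uIoc_of_le h0] at hs'
    rw [hmid s hs'.1.le (lt_of_le_of_ne (hs'.2.trans h1) hs)]
  have hyr : ∀ r : ℝ, 0 ≤ r → r ≤ p → (y r.toNNReal : F) = y 0 + ∫ s in (0 : ℝ)..r, f (m s) := by
    intro r h0 h1
    rw [hcongr r h0 h1, hy, Real.coe_toNNReal r h0]
  have hzero : ∫ s in (0 : ℝ)..p, f (m s) = 0 := by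
    have := hyr p hp'.le le_rfl
    rwa [Real.toNNReal_coe, hyp, left_eq_add] at this
  set g : ℝ → F := fun t => ∫ s in (0 : ℝ)..t, f (m s) with hg
  have hgper : Function.Periodic g p := fun t => by
    have h1 := (hmper.comp f).intervalIntegral_add_eq t 0
    simp only [Function.comp_def, zero_add, hzero] at h1
    rw [← intervalIntegral.integral_interval_sub_left (hfint 0 _) (hfint 0 _)] at h1
    exact sub_eq_zero.1 h1
  have hYg : ∀ t : ℝ≥0, (y (m t).toNNReal : F) = y 0 + g t := by
    intro t
    rw [hyr _ (hm0 t) (hmp t).le]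
    congr 1
    change g (m t) = g t
    rw [hmsub, hgper.sub_zsmul_eq]
  have hYc : Continuous fun t : ℝ≥0 => y (m t).toNNReal := by
    rw [continuous_induced_rng]
    simp only [Function.comp_def, hYg]
    exact continuous_const.add
      ((intervalIntegral.continuous_primitive hfint 0).comp NNReal.continuous_coe)
  refine ⟨⟨_, hYc⟩, fun i s => v i (m s), fun t => ⟨_, rfl⟩, fun t => ?_,
    ⟨fun i => (hv.measurable i).comp hmm, fun i s => hv.nonneg i _, fun s => hv.sum_eq_one _⟩,
    fun i s => congrArg (v i) (hmper s), fun t => ?_⟩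
  · simp only [ContinuousMap.coe_mk, NNReal.coe_add, hmper (t : ℝ)]
  · simp only [ContinuousMap.coe_mk]
    rw [hYg t, NNReal.coe_zero, hmid 0 le_rfl hp', Real.toNNReal_zero]
    congr 1
    refine intervalIntegral.integral_congr fun s hs => ?_
    rw [Set.uIcc_of_le t.coe_nonneg] at hs
    simp only [hf, Real.coe_toNNReal s hs.1]

theorem exists_constant_of_mem_stdSimplex {Ψ : Fin N → Z → F} {z : Z} {l : Fin N → ℝ}
    (hl : l ∈ stdSimplex ℝ (Fin N)) (hlz : ∑ i, l i • Ψ i z = 0) :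
    ∃ (Y : C(ℝ≥0, Z)) (V : Fin N → ℝ → ℝ), (∀ t, Y t = z) ∧ (∀ t, Y (t + 1) = Y t) ∧
      IsSimplexLaw V ∧ (∀ i s, V i (s + (1 : ℝ≥0)) = V i s) ∧
      ∀ t : ℝ≥0, (Y t : F) = Y 0 + ∫ s in (0 : ℝ)..t, ∑ i, V i s • Ψ i (Y s.toNNReal) :=
  ⟨.const _ z, fun i _ => l i, fun _ => rfl, fun _ => rfl,
    ⟨fun _ => measurable_const, fun i _ => hl.1 i, fun _ => hl.2⟩, fun _ _ => rfl,
    fun t => by simp [hlz]⟩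

end Periodic

section Chart

theorem mul_sub_le_sub_of_local {G : ℝ → ℝ} {c d s t : ℝ} (hd : 0 < d) (hst : s ≤ t)
    (h : ∀ a b, s ≤ a → a ≤ b → b ≤ t → b - a ≤ d → c * (b - a) ≤ G b - G a) :
    c * (t - s) ≤ G t - G s := by
  have key : ∀ n : ℕ, ∀ b, s ≤ b → b ≤ t → b - s ≤ n * d → c * (b - s) ≤ G b - G s := by
    intro n
    induction n with
    | zero =>
      intro b hb _ hbn
      have : b = s := by push_cast at hbn; linarith
      simp [this]
    | succ n ih =>
      intro b hb hbt hbn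
      push_cast at hbn
      have h1 := h (max s (b - d)) b (le_max_left _ _) (max_le hb (by linarith)) hbt
        (by linarith [le_max_right s (b - d)])
      have h2 := ih (max s (b - d)) (le_max_left _ _) (max_le (hb.trans hbt) (by linarith)) (by
        rcases max_choice s (b - d) with h' | h' <;> rw [h']
        · rw [sub_self]; positivity
        · linarith)
      linarith
  obtain ⟨n, hn⟩ := exists_nat_ge ((t - s) / d)
  exact key n t hst le_rfl ((div_le_iff₀ hd).1 hn)

variable {N : ℕ} {F : Type*} [NormedAddCommGroup F] [NormedSpace ℝ F] {Z : Set F}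

/-- In a chart in which all the vector fields point to the right at `y 1`, the real part of the
trajectory increases at a linear rate near `y 1`. -/
theorem IsSwitchedTrajectory.exists_pos_increase [CompactSpace Z] {Ψ : Fin N → Z → F}
    (hΨ : ∀ i, Continuous (Ψ i)) {δ : ℝ → ℝ} (hδ : ∀ ε > 0, 0 < δ ε) {y : ℝ≥0 → Z}
    {U : ℝ≥0 → Fin N → ℝ} (h : IsSwitchedTrajectory Ψ δ y U) {f : F → ℂ} {f' : F →L[ℝ] ℂ} {z : Z}
    (hf' : HasStrictFDerivAt f f' (z : F)) {c : ℝ} (hc0 : 0 < c)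
    (hc : ∀ i, c ≤ (f' (Ψ i z)).re) :
    ∃ ρ > 0, ∀ s t : ℝ≥0, s ≤ t →
      (∀ τ ∈ Set.Icc s t, dist (y τ : F) z < ρ) →
      c / 4 * (t - s) ≤ (f (y t)).re - (f (y s)).re := by
  obtain ⟨B, hB0, hB⟩ := exists_norm_le_of_continuous hΨ
  have hB1 : 0 < B + 1 := by linarith
  obtain ⟨ρ₁, hρ₁, h₁⟩ := Metric.eventually_nhds_iff.1 (hf'.isLittleO.def
    (show 0 < c / (8 * (B + 1)) by positivity))
  have h₂ : ∀ᶠ q in 𝓝 z, ∀ i, c / 2 < (f' (Ψ i q)).re := eventually_all.2 fun i =>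
    (Complex.continuous_re.comp (f'.continuous.comp (hΨ i))).continuousAt.eventually
      (lt_mem_nhds ((half_lt_self hc0).trans_le (hc i)))
  obtain ⟨ρ₂, hρ₂, h₂⟩ := Metric.eventually_nhds_iff.1 h₂
  set ε := c / (8 * (‖f'‖ + 1)) with hε
  have hε0 : 0 < ε := by positivity
  refine ⟨min ρ₁ ρ₂, lt_min hρ₁ hρ₂, fun s t hst hτ => ?_⟩
  have key := mul_sub_le_sub_of_local (G := fun r => (f (y r.toNNReal)).re) (c := c / 4)
    (lt_min (hδ 1 one_pos) (hδ ε hε0)) (NNReal.coe_le_coe.2 hst) ?_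
  · simpa only [Real.toNNReal_coe] using key
  intro a b ha hab hb hd
  lift a to ℝ≥0 using s.coe_nonneg.trans ha
  lift b to ℝ≥0 using a.coe_nonneg.trans hab
  simp only [Real.toNNReal_coe]
  rw [NNReal.coe_le_coe] at ha hab hb
  have hda := hτ a ⟨ha, hab.trans hb⟩
  have hdb := hτ b ⟨ha.trans hab, hb⟩
  have hab' := NNReal.coe_le_coe.2 hab
  have e1 := h.approx ε hε0 a b hab (hd.trans (min_le_right _ _))
  have e2 := h.norm_sub_le hB hab (hd.trans (min_le_left _ _))
  have e3 := @h₁ ((y b : F), (y a : F)) (by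
    rw [Prod.dist_eq]
    exact max_lt (hdb.trans_le (min_le_left _ _)) (hda.trans_le (min_le_left _ _)))
  have e4 := @h₂ (y a) (hda.trans_le (min_le_right _ _))
  have e5 : c / 2 * (b - a) ≤ (f' (∑ i, (U b i - U a i) • Ψ i (y a))).re := by
    rw [map_sum, Complex.re_sum, ← h.sum_sub a b, Finset.mul_sum]
    refine Finset.sum_le_sum fun i _ => ?_
    rw [map_smul, Complex.smul_re, smul_eq_mul, mul_comm]
    exact mul_le_mul_of_nonneg_left (e4 i).le (h.sub_nonneg hab i)
  have e6 : |(f' ((y b : F) - y a - ∑ i, (U b i - U a i) • Ψ i (y a))).re| ≤ c / 8 * (b - a) := by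
    refine (Complex.abs_re_le_norm _).trans ((f'.le_opNorm _).trans ?_)
    calc ‖f'‖ * ‖(y b : F) - y a - ∑ i, (U b i - U a i) • Ψ i (y a)‖
        ≤ (‖f'‖ + 1) * (ε * (b - a)) :=
          mul_le_mul (by linarith) e1 (norm_nonneg _) (by positivity)
      _ = c / 8 * (b - a) := by rw [hε]; field_simp
  have e7 : |(f (y b) - f (y a) - f' ((y b : F) - y a)).re| ≤ c / 8 * (b - a) := by
    refine (Complex.abs_re_le_norm _).trans (e3.trans ?_)
    calc c / (8 * (B + 1)) * ‖(y b : F) - y a‖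
        ≤ c / (8 * (B + 1)) * ((B + 1) * (b - a)) := by gcongr
      _ = c / 8 * (b - a) := by field_simp
  rw [map_sub, Complex.sub_re] at e6
  rw [Complex.sub_re, Complex.sub_re] at e7
  linarith [(abs_le.1 e6).1, (abs_le.1 e7).1]

theorem IsSwitchedTrajectory.not_injective_of_chart [CompactSpace Z] {Ψ : Fin N → Z → F}
    (hΨ : ∀ i, Continuous (Ψ i)) {δ : ℝ → ℝ} (hδ : ∀ ε > 0, 0 < δ ε) {y : ℝ≥0 → Z}
    {U : ℝ≥0 → Fin N → ℝ} (h : IsSwitchedTrajectory Ψ δ y U)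
    (hrec : ∀ s T, ∀ ε > 0, ∃ t ≥ T, dist (y t : F) (y s) < ε)
    {f : F → ℂ} {f' : F →L[ℝ] ℂ} {g : ℂ → F} (hg : Continuous g)
    (hgf : ∀ t > 0, g (f (y t)) = y t) (hfc : ∀ t > 0, ContinuousAt f (y t : F))
    (hf' : HasStrictFDerivAt f f' (y 1 : F)) {c : ℝ} (hc0 : 0 < c)
    (hc : ∀ i, c ≤ (f' (Ψ i (y 1))).re) : ¬ Function.Injective y := by
  intro hinj
  obtain ⟨B, hB0, hB⟩ := exists_norm_le_of_continuous hΨ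
  have hyc := h.continuous hΨ hδ
  have hpos : ∀ {t : ℝ}, 0 < t → 0 < t.toNNReal := fun ht => Real.toNNReal_pos.2 ht
  set w : ℝ → ℂ := fun t => f (y t.toNNReal) - f (y 1) with hw
  have hinv : ∀ ρ > 0, ∃ r > 0, ∀ t : ℝ, 0 < t → ‖w t‖ < r → dist (y t.toNNReal : F) (y 1) < ρ := by
    intro ρ hρ
    obtain ⟨r, hr, hr'⟩ := Metric.continuousAt_iff.1 (hg.continuousAt (x := f (y 1))) ρ hρ
    refine ⟨r, hr, fun t ht hwt => ?_⟩
    have := hr' (x := f (y t.toNNReal)) (by rwa [dist_eq_norm])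
    rwa [hgf _ (hpos ht), hgf 1 one_pos] at this
  obtain ⟨ρ, hρ, hinc⟩ := h.exists_pos_increase hΨ hδ hf' hc0 hc
  obtain ⟨r, hr, hr'⟩ := hinv ρ hρ
  refine not_recurrent_of_injOn (w := w) (r := r) (c := c / 4) hr (by positivity) ?_ ?_ ?_ ?_ ?_ ?_
  · intro t ht
    have h1 : ContinuousAt (fun s : ℝ => (y s.toNNReal : F)) t :=
      (continuous_subtype_val.comp (hyc.comp continuous_real_toNNReal)).continuousAt
    exact ((ContinuousAt.comp (f := fun s : ℝ => (y s.toNNReal : F)) (hfc _ (hpos ht)) h1).sub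
      continuousAt_const).continuousWithinAt
  · intro s hs t ht hst
    have h1 : f (y s.toNNReal) = f (y t.toNNReal) := sub_left_injective hst
    have h2 := congrArg g h1
    rw [hgf _ (hpos hs), hgf _ (hpos ht)] at h2
    exact (Real.toNNReal_eq_toNNReal_iff (le_of_lt hs) (le_of_lt ht)).1 (hinj (Subtype.ext h2))
  · intro s hs T ε hε
    obtain ⟨η, hη, hη'⟩ := Metric.continuousAt_iff.1 (hfc _ (hpos hs)) ε hε
    obtain ⟨t, ht, hts⟩ := hrec s.toNNReal (T.toNNReal + 1) η hη
    have ht' : T < t := by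
      have h1 : ((T.toNNReal + 1 : ℝ≥0) : ℝ) ≤ t := NNReal.coe_le_coe.2 ht
      push_cast at h1
      linarith [Real.le_coe_toNNReal T]
    refine ⟨t, ht', ?_⟩
    have h2 := hη' hts
    simpa only [hw, Real.toNNReal_coe, dist_sub_right] using h2
  · simp [hw]
  · intro s t hs hst hτ
    have hs' := Real.coe_toNNReal s hs.le
    have ht' := Real.coe_toNNReal t (hs.le.trans hst)
    have h1 := hinc s.toNNReal t.toNNReal (Real.toNNReal_mono hst) fun τ hτ' => by
      have h2 : s ≤ τ := by rw [← hs']; exact hτ'.1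
      have h3 : (τ : ℝ) ≤ t := by rw [← ht']; exact hτ'.2
      have h4 := hr' τ (hs.trans_le h2) (hτ τ ⟨h2, h3⟩)
      rwa [Real.toNNReal_coe] at h4
    rw [hs', ht'] at h1
    simpa only [hw, Complex.sub_re, sub_sub_sub_cancel_right] using h1
  · intro ρ' hρ'
    obtain ⟨η, hη, hη'⟩ := Metric.continuousAt_iff.1 (hfc 1 one_pos) ρ' hρ'
    obtain ⟨ε₁, hε₁, hε₁'⟩ := hinv (η / 2) (half_pos hη)
    refine ⟨min ε₁ (min (δ 1) (η / (2 * (B + 1)))),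
      lt_min hε₁ (lt_min (hδ 1 one_pos) (by positivity)), fun T hT hwT τ hτ => ?_⟩
    have h1 := hε₁' T hT (hwT.trans_le (min_le_left _ _))
    have h2 := (hτ.2.trans (min_le_right _ _)).trans (min_le_left _ _)
    have h3 := (hτ.2.trans (min_le_right _ _)).trans (min_le_right _ _)
    have h4 : (((T + τ).toNNReal : ℝ≥0) : ℝ) - T.toNNReal = τ := by
      rw [Real.coe_toNNReal _ (by linarith [hτ.1]), Real.coe_toNNReal _ hT.le]
      ring
    have h5 := h.norm_sub_le hB (Real.toNNReal_mono (show T ≤ T + τ by linarith [hτ.1]))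
      (by rw [h4]; exact h2)
    rw [h4, ← dist_eq_norm] at h5
    rw [le_div_iff₀ (by positivity)] at h3
    have h6 : dist (y (T + τ).toNNReal : F) (y 1) < η :=
      (dist_triangle _ (y T.toNNReal : F) _).trans_lt (by linarith)
    have h7 := hη' h6
    rwa [dist_eq_norm] at h7

end Chart

section Stereographic

/-- Stereographic projection from a pole `b`, as a map defined on the ambient space. -/
theorem exists_stereographic_chart {b : EuclideanSpace ℝ (Fin 3)} (hb : ‖b‖ = 1) :
    ∃ (f : EuclideanSpace ℝ (Fin 3) → ℂ) (g : ℂ → EuclideanSpace ℝ (Fin 3)), Continuous g ∧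
      ∀ p, ‖p‖ = 1 → p ≠ b → g (f p) = p ∧ ContDiffAt ℝ 1 f p ∧
        ∀ q, ⟪q, p⟫ = 0 → fderiv ℝ f p q = 0 → q = 0 := by
  obtain ⟨e, he⟩ : ∃ e : OrthonormalBasis (Fin 3) ℝ (EuclideanSpace ℝ (Fin 3)), e 2 = b := by
    obtain ⟨e, he⟩ := Orthonormal.exists_orthonormalBasis_extension_of_card_eq
      (𝕜 := ℝ) (E := EuclideanSpace ℝ (Fin 3)) (ι := Fin 3) (by simp) (v := fun _ => b)
      (s := {2}) (by
        rw [orthonormal_iff_ite]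
        rintro ⟨i, rfl⟩ ⟨j, rfl⟩
        simp [hb])
    exact ⟨e, he 2 rfl⟩
  set A : EuclideanSpace ℝ (Fin 3) →L[ℝ] ℂ :=
    Complex.ofRealCLM.comp (innerSL ℝ (e 0)) +
      (Complex.I • Complex.ofRealCLM).comp (innerSL ℝ (e 1)) with hA
  have hAre : ∀ p, (A p).re = ⟪e 0, p⟫ := fun p => by simp [hA]
  have hAim : ∀ p, (A p).im = ⟪e 1, p⟫ := fun p => by simp [hA]
  set f : EuclideanSpace ℝ (Fin 3) → ℂ := fun p => (1 - ⟪b, p⟫)⁻¹ • A p with hf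
  set g : ℂ → EuclideanSpace ℝ (Fin 3) := fun ζ => (ζ.re ^ 2 + ζ.im ^ 2 + 1)⁻¹ •
    ((2 * ζ.re) • e 0 + (2 * ζ.im) • e 1 + (ζ.re ^ 2 + ζ.im ^ 2 - 1) • e 2) with hg
  have hgc : Continuous g := by
    have h1 : Continuous fun ζ : ℂ => ζ.re ^ 2 + ζ.im ^ 2 + 1 := by fun_prop
    exact (h1.inv₀ fun ζ => by positivity).smul (by fun_prop)
  refine ⟨f, g, hgc, fun p hp hpb => ?_⟩
  have hk : 1 - ⟪b, p⟫ ≠ 0 := by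
    rw [sub_ne_zero]
    exact fun h => hpb ((inner_eq_one_iff_of_norm_eq_one hb hp).1 h.symm).symm
  have hcoord : ∀ q, ⟪e 0, q⟫ • e 0 + ⟪e 1, q⟫ • e 1 + ⟪b, q⟫ • b = q := fun q => by
    have := e.sum_repr' q
    rwa [Fin.sum_univ_three, he] at this
  have hinner : ∀ q r, ⟪e 0, q⟫ * ⟪e 0, r⟫ + ⟪e 1, q⟫ * ⟪e 1, r⟫ + ⟪b, q⟫ * ⟪b, r⟫ = ⟪q, r⟫ :=
    fun q r => by
      have := e.sum_inner_mul_inner q r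
      rwa [Fin.sum_univ_three, he, real_inner_comm (e 0) q, real_inner_comm (e 1) q,
        real_inner_comm b q] at this
  have hpp := hinner p p
  rw [real_inner_self_eq_norm_sq, hp] at hpp
  have hfd : ContDiffAt ℝ 1 f p := by
    have h1 : ContDiffAt ℝ 1 (fun p => 1 - ⟪b, p⟫) p :=
      contDiffAt_const.sub (contDiffAt_const.inner ℝ contDiffAt_id)
    exact (h1.inv hk).smul A.contDiff.contDiffAt
  refine ⟨?_, hfd, fun q hq hfq => ?_⟩
  · have hre : (f p).re = (1 - ⟪b, p⟫)⁻¹ * ⟪e 0, p⟫ := by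
      simp only [hf, Complex.smul_re, smul_eq_mul, hAre]
    have him : (f p).im = (1 - ⟪b, p⟫)⁻¹ * ⟪e 1, p⟫ := by
      simp only [hf, Complex.smul_im, smul_eq_mul, hAim]
    conv_rhs => rw [← hcoord p]
    simp only [hg, hre, him, he]
    set k := 1 - ⟪b, p⟫ with hkdef
    have hb' : ⟪b, p⟫ = 1 - k := by rw [hkdef]; ring
    rw [hb'] at hpp ⊢
    have hs : (k⁻¹ * ⟪e 0, p⟫) ^ 2 + (k⁻¹ * ⟪e 1, p⟫) ^ 2 = 2 * k⁻¹ - 1 := by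
      field_simp
      linarith
    have hs' : (2 * k⁻¹ - 1 + 1)⁻¹ = k / 2 := by field_simp; ring
    rw [hs, hs']
    match_scalars <;> field_simp
    ring
  · have h1 : HasFDerivAt (fun p => 1 - ⟪b, p⟫) (-(innerSL ℝ b)) p :=
      ((innerSL ℝ b).hasFDerivAt).const_sub 1
    have h2 := h1.smul (hfd.differentiableAt one_ne_zero).hasFDerivAt
    have h3 : (fun p => 1 - ⟪b, p⟫) • f =ᶠ[𝓝 p] A := by
      have : ∀ᶠ r in 𝓝 p, 1 - ⟪b, r⟫ ≠ 0 := h1.continuousAt.eventually_ne hk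
      filter_upwards [this] with r hr
      simp only [hf, Pi.smul_apply', smul_smul, mul_inv_cancel₀ hr, one_smul]
    have h4 : A q = -(⟪b, q⟫ • (1 - ⟪b, p⟫)⁻¹ • A p) := by
      have h5 := DFunLike.congr_fun ((A.hasFDerivAt.congr_of_eventuallyEq h3).unique h2) q
      rw [h5]
      change (1 - ⟪b, p⟫) • fderiv ℝ f p q + (-⟪b, q⟫) • f p = -(⟪b, q⟫ • f p)
      rw [hfq, smul_zero, zero_add, neg_smul]
    have h5 : ⟪e 0, q⟫ = -(⟪b, q⟫ * ((1 - ⟪b, p⟫)⁻¹ * ⟪e 0, p⟫)) := by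
      simpa only [hAre, Complex.neg_re, Complex.smul_re, smul_eq_mul] using congrArg Complex.re h4
    have h6 : ⟪e 1, q⟫ = -(⟪b, q⟫ * ((1 - ⟪b, p⟫)⁻¹ * ⟪e 1, p⟫)) := by
      simpa only [hAim, Complex.neg_im, Complex.smul_im, smul_eq_mul] using congrArg Complex.im h4
    have h7 : ⟪b, q⟫ = 0 := by
      have h8 := hinner q p
      rw [hq, h5, h6] at h8
      field_simp at h8
      have h9 : (1 - ⟪b, p⟫) * ⟪b, q⟫ = 0 := by linear_combination -h8 - ⟪b, q⟫ * hpp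
      exact (mul_eq_zero.1 h9).resolve_left hk
    rw [← hcoord q, h5, h6, h7]
    simp

end Stereographic

section Sphere

variable {N : ℕ}

/-- Complex numbers having no vanishing convex combination lie, after a rotation, in an open right
half plane. -/
theorem exists_mul_re_ge_of_stdSimplex {q : Fin N → ℂ}
    (hq : ∀ l ∈ stdSimplex ℝ (Fin N), ∑ i, l i • q i ≠ 0) :
    ∃ κ : ℂ, κ ≠ 0 ∧ ∃ c > 0, ∀ i, c ≤ (κ * q i).re := by
  rcases isEmpty_or_nonempty (Fin N) with _ | ⟨⟨i₀⟩⟩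
  · exact ⟨1, one_ne_zero, 1, one_pos, isEmptyElim⟩
  set L : (Fin N → ℝ) →ₗ[ℝ] ℂ := Fintype.linearCombination ℝ q with hL
  have hLc : Continuous L := L.continuous_of_finiteDimensional
  have h0 : (0 : ℂ) ∉ L '' stdSimplex ℝ (Fin N) := by
    rintro ⟨l, hl, hl0⟩
    exact hq l hl (by simpa [hL, Fintype.linearCombination_apply] using hl0)
  obtain ⟨f, c, hc, hf⟩ := geometric_hahn_banach_point_closed
    ((convex_stdSimplex ℝ (Fin N)).is_linear_image L.isLinear)
    ((isCompact_stdSimplex (𝕜 := ℝ) (Fin N)).image hLc).isClosed h0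
  rw [map_zero] at hc
  have hfz : ∀ z : ℂ, f z = (((f 1 : ℂ) - f Complex.I * Complex.I) * z).re := by
    intro z
    have : z = z.re • (1 : ℂ) + z.im • Complex.I := by simp
    conv_lhs => rw [this]
    rw [map_add, map_smul, map_smul]
    simp
    ring
  have hle : ∀ i, c ≤ (((f 1 : ℂ) - f Complex.I * Complex.I) * q i).re := fun i => by
    rw [← hfz]
    refine (hf _ ⟨Pi.single i 1, single_mem_stdSimplex ℝ i, ?_⟩).le
    rw [hL, Fintype.linearCombination_apply_single, one_smul]
  refine ⟨_, fun h => ?_, c, hc, hle⟩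
  have := hle i₀
  rw [h, zero_mul, Complex.zero_re] at this
  linarith

/-- A recurrent trajectory on the sphere is not injective unless some convex combination of the
vector fields vanishes at one of its points. -/
theorem IsSwitchedTrajectory.not_injective_of_sphere {Z : Set (EuclideanSpace ℝ (Fin 3))}
    [CompactSpace Z] (hZs : Z ⊆ Metric.sphere (0 : EuclideanSpace ℝ (Fin 3)) 1)
    {Ψ : Fin N → Z → EuclideanSpace ℝ (Fin 3)} (hΨ : ∀ i, Continuous (Ψ i))
    (htan : ∀ (i : Fin N) (z : Z), ⟪Ψ i z, (z : EuclideanSpace ℝ (Fin 3))⟫ = 0)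
    {δ : ℝ → ℝ} (hδ : ∀ ε > 0, 0 < δ ε) {y : ℝ≥0 → Z} {U : ℝ≥0 → Fin N → ℝ}
    (h : IsSwitchedTrajectory Ψ δ y U)
    (hrec : ∀ s T, ∀ ε > 0, ∃ t ≥ T, dist (y t : EuclideanSpace ℝ (Fin 3)) (y s) < ε)
    (hne : ∀ l ∈ stdSimplex ℝ (Fin N), ∑ i, l i • Ψ i (y 1) ≠ 0) :
    ¬ Function.Injective y := by
  intro hinj
  have hnorm : ∀ t, ‖(y t : EuclideanSpace ℝ (Fin 3))‖ = 1 := fun t => by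
    simpa using hZs (y t).2
  obtain ⟨f, g, hg, hfg⟩ := exists_stereographic_chart (hnorm 0)
  have hy : ∀ t > 0, (y t : EuclideanSpace ℝ (Fin 3)) ≠ y 0 := fun t ht ht0 =>
    ht.ne' (hinj (Subtype.ext ht0))
  have hf : ∀ t > 0, g (f (y t)) = y t ∧ ContDiffAt ℝ 1 f (y t : EuclideanSpace ℝ (Fin 3)) ∧ _ :=
    fun t ht => hfg _ (hnorm t) (hy t ht)
  obtain ⟨κ, hκ, c, hc0, hc⟩ := exists_mul_re_ge_of_stdSimplex
    (q := fun i => fderiv ℝ f (y 1) (Ψ i (y 1))) fun l hl hl0 => by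
      refine hne l hl ((hf 1 one_pos).2.2 _ ?_ (by simpa using hl0))
      simp [sum_inner, inner_smul_left, htan]
  refine h.not_injective_of_chart (f := fun p => κ * f p) (f' := κ • fderiv ℝ f (y 1))
    (g := fun w => g (κ⁻¹ * w)) hΨ hδ hrec (by fun_prop) (fun t ht => ?_) (fun t ht => ?_) ?_
    hc0 hc hinj
  · rw [inv_mul_cancel_left₀ hκ, (hf t ht).1]
  · exact continuousAt_const.mul (hf t ht).2.1.continuousAt
  · exact ((hf 1 one_pos).2.1.hasStrictFDerivAt one_ne_zero).const_mul κ

end Sphere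

/-- Poincaré–Bendixson theorem for switched continuous vector fields on a compact subset
of the sphere: any trajectory admits a periodic trajectory, generated by a periodic
switching law, taking values in its ω-limit set. -/
theorem switched_vector_fields_sphere_periodic_limit_trajectory
    (Z : Set (EuclideanSpace ℝ (Fin 3))) (hZc : IsCompact Z)
    (hZs : Z ⊆ Metric.sphere (0 : EuclideanSpace ℝ (Fin 3)) 1)
    (N : ℕ) (Ψ : Fin N → Z → EuclideanSpace ℝ (Fin 3)) (hΨ : ∀ i, Continuous (Ψ i))
    (htan : ∀ (i : Fin N) (z : Z), ⟪Ψ i z, (z : EuclideanSpace ℝ (Fin 3))⟫ = 0)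
    (x : C(ℝ≥0, Z)) (u : Fin N → ℝ → ℝ) (hu : IsSwitchingLaw u)
    (hx : ∀ t : ℝ≥0, (x t : EuclideanSpace ℝ (Fin 3)) =
      (x 0 : EuclideanSpace ℝ (Fin 3)) +
        ∫ s in Set.Ioc (0 : ℝ) (t : ℝ), ∑ i, u i s • Ψ i (x (Real.toNNReal s))) :
    ∃ (p : ℝ≥0) (y : C(ℝ≥0, Z)) (v : Fin N → ℝ → ℝ), 0 < p ∧
      (∀ t : ℝ≥0, (y t : EuclideanSpace ℝ (Fin 3)) ∈
        ⋂ T : ℝ≥0, closure ((fun r : ℝ≥0 => (x r : EuclideanSpace ℝ (Fin 3))) '' Set.Ici T)) ∧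
      (∀ t : ℝ≥0, y (t + p) = y t) ∧
      IsSwitchingLaw v ∧
      (∀ i, ∀ᵐ s ∂(volume.restrict (Set.Ici (0 : ℝ))), v i (s + (p : ℝ)) = v i s) ∧
      (∀ t : ℝ≥0, (y t : EuclideanSpace ℝ (Fin 3)) =
        (y 0 : EuclideanSpace ℝ (Fin 3)) +
          ∫ s in Set.Ioc (0 : ℝ) (t : ℝ), ∑ i, v i s • Ψ i (y (Real.toNNReal s))) := by
  have : CompactSpace Z := isCompact_iff_compactSpace.1 hZc
  obtain ⟨v, hv, hvu⟩ := hu.exists_isSimplexLaw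
  obtain ⟨δ, U, hδ, hU⟩ := hv.exists_isSwitchedTrajectory hΨ x.continuous fun t => by
    rw [hx t, intervalIntegral.integral_of_le t.coe_nonneg]
    congr 1
    refine integral_congr_ae ?_
    filter_upwards [ae_restrict_of_ae_restrict_of_subset
      (fun s hs => hs.1.le : Set.Ioc (0 : ℝ) t ⊆ Set.Ici 0) hvu] with s hs
    simp only [hs]
  obtain ⟨y, W, hW, hyx, hrec⟩ := exists_recurrent_isSwitchedTrajectory hΨ ⟨U, hU⟩
  obtain ⟨p, Y, V, hp, hYy, hYp, hV, hVp, hY⟩ : ∃ (p : ℝ≥0) (Y : C(ℝ≥0, Z)) (V : Fin N → ℝ → ℝ),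
      0 < p ∧ (∀ t, ∃ s, Y t = y s) ∧ (∀ t, Y (t + p) = Y t) ∧ IsSimplexLaw V ∧
      (∀ i s, V i (s + p) = V i s) ∧
      ∀ t : ℝ≥0, (Y t : EuclideanSpace ℝ (Fin 3)) =
        Y 0 + ∫ s in (0 : ℝ)..t, ∑ i, V i s • Ψ i (Y s.toNNReal) := by
    by_cases hne : ∀ l ∈ stdSimplex ℝ (Fin N), ∑ i, l i • Ψ i (y 1) ≠ 0
    · have hinj := hW.not_injective_of_sphere hZs hΨ htan hδ hrec hne
      obtain ⟨s₀, s₁, hs, hlt⟩ : ∃ s₀ s₁, y s₀ = y s₁ ∧ s₀ < s₁ := by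
        simp only [Function.Injective, not_forall] at hinj
        obtain ⟨a, b, hab, hne⟩ := hinj
        rcases lt_or_gt_of_ne hne with h | h
        exacts [⟨a, b, hab, h⟩, ⟨b, a, hab.symm, h⟩]
      obtain ⟨v', hv', hy'⟩ := (hW.shift s₀).exists_integral_eq hΨ hδ
      obtain ⟨Y, V, hYy, hY⟩ := hv'.exists_periodic hΨ ((hW.shift s₀).continuous hΨ hδ) hy'
        (tsub_pos_of_lt hlt) (by rw [add_tsub_cancel_of_le hlt.le, add_zero, hs])
      exact ⟨s₁ - s₀, Y, V, tsub_pos_of_lt hlt, fun t => (hYy t).imp' (s₀ + ·) fun _ => id, hY⟩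
    · push Not at hne
      obtain ⟨l, hl, hl0⟩ := hne
      obtain ⟨Y, V, hYy, hY⟩ := exists_constant_of_mem_stdSimplex hl hl0
      exact ⟨1, Y, V, one_pos, fun t => ⟨1, hYy t⟩, hY⟩
  refine ⟨p, Y, V, hp, fun t => ?_, hYp, hV.isSwitchingLaw, fun i => ae_of_all _ (hVp i),
    fun t => ?_⟩
  · obtain ⟨s, hs⟩ := hYy t
    rw [hs]
    exact hyx s
  · rw [hY t, intervalIntegral.integral_of_le t.coe_nonneg]
end

section
/- Let Ψ₁,…,Ψ_N : ℝ^d → ℝ^d be homogeneous and uniformly Lipschitz continuous, and suppose that the switched system defined by Ψ₁,…,Ψ_N is Lyapunov stable. Let Z ⊂ ℝ^d∖{0} be a compact set such that the set 𝔛_Z of trajectories taking values only in Z is nonempty, and suppose Z has no proper nonempty compact subset Z′ with 𝔛_{Z′} nonempty. Then the map v ↦ v/‖v‖ is injective on Z, and hence restricts to a homeomorphism of Z onto a compact subset of the unit sphere S^{d−1}. -/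
open scoped NNReal
open Filter Topology MeasureTheory

/-- `x : [0,∞) → ℝ^d` is the trajectory of the switched system defined by `Ψ₁,…,Ψ_N`
generated by the switching law `u`. -/
def IsTrajectoryWith {d N : ℕ} (Ψ : Fin N → EuclideanSpace ℝ (Fin d) → EuclideanSpace ℝ (Fin d))
    (u : Fin N → ℝ → ℝ) (x : ℝ≥0 → EuclideanSpace ℝ (Fin d)) : Prop :=
  Continuous x ∧ IsSwitchingLaw u ∧
  ∀ t : ℝ≥0, x t = x 0 + ∫ s in Set.Ioc (0 : ℝ) (t : ℝ), ∑ i, u i s • Ψ i (x (Real.toNNReal s))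

/-- `x` is a trajectory of the switched system defined by `Ψ₁,…,Ψ_N`. -/
def IsTrajectory {d N : ℕ} (Ψ : Fin N → EuclideanSpace ℝ (Fin d) → EuclideanSpace ℝ (Fin d))
    (x : ℝ≥0 → EuclideanSpace ℝ (Fin d)) : Prop :=
  ∃ u, IsTrajectoryWith Ψ u x


namespace SwitchedSystem

section Basic

variable {E : Type*} [NormedAddCommGroup E] [NormedSpace ℝ E]

/-- The velocity `s ↦ Σᵢ uᵢ(s) Ψᵢ(x(s))` along a curve `x` under the switching law `u`. -/
noncomputable def velocity {N : ℕ} (Ψ : Fin N → E → E) (u : Fin N → ℝ → ℝ) (x : ℝ≥0 → E)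
    (s : ℝ) : E :=
  ∑ i, u i s • Ψ i (x s.toNNReal)

/-- A curve which is quadratically close to being constant is constant. -/
lemma eq_of_norm_sub_le_sq {f : ℝ≥0 → E} {C : ℝ}
    (hf : ∀ s r : ℝ≥0, s ≤ r → ‖f r - f s‖ ≤ C * ((r : ℝ) - s) ^ 2) (t : ℝ≥0) : f t = f 0 := by
  have hC : 0 ≤ C := by simpa using (norm_nonneg _).trans (hf 0 1 zero_le_one)
  have key : ∀ s r : ℝ, ‖f r.toNNReal - f s.toNNReal‖ ≤ C * ‖r - s‖ ^ 2 := by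
    intro s r
    wlog h : s ≤ r generalizing s r
    · rw [norm_sub_rev, norm_sub_rev r]
      exact this r s (le_of_not_ge h)
    refine (hf _ _ (Real.toNNReal_le_toNNReal h)).trans ?_
    gcongr
    · exact sub_nonneg.2 (NNReal.coe_le_coe.2 (Real.toNNReal_le_toNNReal h))
    · rw [Real.coe_toNNReal', Real.coe_toNNReal', Real.norm_eq_abs]
      exact (le_abs_self _).trans ((abs_max_sub_max_le_max _ _ _ _).trans (by simp))
  have hderiv : ∀ s : ℝ, HasFDerivAt (fun r : ℝ => f r.toNNReal) (0 : ℝ →L[ℝ] E) s := by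
    intro s
    have h : HasFDerivAt (fun r : ℝ => f r.toNNReal - f s.toNNReal) (0 : ℝ →L[ℝ] E) s :=
      Asymptotics.IsBigO.hasFDerivAt (n := 2)
        (Asymptotics.IsBigO.of_bound C (Eventually.of_forall fun r => by simpa using key s r))
        one_lt_two
    simpa using h.add_const (f s.toNNReal)
  have := is_const_of_fderiv_eq_zero (𝕜 := ℝ) (fun s => (hderiv s).differentiableAt)
    (fun s => (hderiv s).fderiv) (t : ℝ) 0
  simpa using this

/-- A function interval integrable on `[0, ∞)` has a continuous primitive there. -/
lemma continuous_primitive {f : ℝ → E}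
    (hf : ∀ t : ℝ≥0, IntervalIntegrable f volume 0 t) :
    Continuous fun t : ℝ≥0 => ∫ s in (0 : ℝ)..t, f s := by
  refine continuous_iff_continuousAt.2 fun t => ?_
  have h := intervalIntegral.continuousOn_primitive_interval' (hf (t + 1)) Set.left_mem_uIcc
  rw [Set.uIcc_of_le (NNReal.coe_nonneg _)] at h
  have h2 := h t ⟨t.2, by simp⟩
  refine (h2.tendsto).comp (tendsto_nhdsWithin_iff.2
    ⟨NNReal.continuous_coe.continuousAt, ?_⟩)
  filter_upwards [Iio_mem_nhds (show t < t + 1 by simp)] with r hr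
  exact ⟨r.2, NNReal.coe_le_coe.2 (le_of_lt hr)⟩

end Basic

section Law

variable {N : ℕ} {u : Fin N → ℝ → ℝ}

lemma ae_of_law (hu : IsSwitchingLaw u) :
    ∀ᵐ s : ℝ, 0 ≤ s → (∀ i, u i s ∈ Set.Icc (0 : ℝ) 1) ∧ ∑ i, u i s = 1 :=
  (ae_restrict_iff' measurableSet_Ici).1 hu.2

lemma intervalIntegrable_law (hu : IsSwitchingLaw u) (i : Fin N) (a b : ℝ≥0) :
    IntervalIntegrable (u i) volume a b := by
  rw [intervalIntegrable_iff]
  refine Measure.integrableOn_of_bounded (M := 1) (by simp [Set.uIoc])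
    (hu.1 i).aestronglyMeasurable ?_
  rw [ae_restrict_iff' measurableSet_uIoc]
  filter_upwards [ae_of_law hu] with s hs hm
  have h0 : 0 ≤ s := (le_min a.2 b.2).trans hm.1.le
  rw [Real.norm_eq_abs, abs_of_nonneg ((hs h0).1 i).1]
  exact ((hs h0).1 i).2

variable {E : Type*} [NormedAddCommGroup E] [NormedSpace ℝ E]
  {Ψ : Fin N → E → E} {x y : ℝ≥0 → E} {L : ℝ≥0}

lemma intervalIntegrable_velocity (hu : IsSwitchingLaw u) (hΨ : ∀ i, Continuous (Ψ i))
    (hx : Continuous x) (a b : ℝ≥0) : IntervalIntegrable (velocity Ψ u x) volume a b := by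
  unfold velocity
  suffices h : ∀ i, IntervalIntegrable (fun s => u i s • Ψ i (x s.toNNReal)) volume a b by
    simpa only [Finset.sum_fn] using IntervalIntegrable.sum Finset.univ fun i _ => h i
  intro i
  exact (intervalIntegrable_law hu i a b).smul_continuousOn
    ((hΨ i).comp (hx.comp continuous_real_toNNReal)).continuousOn

lemma norm_sum_smul_le {w : Fin N → ℝ} (hw : ∀ i, w i ∈ Set.Icc (0 : ℝ) 1) (hw1 : ∑ i, w i = 1)
    {p : Fin N → E} {M : ℝ} (hp : ∀ i, ‖p i‖ ≤ M) : ‖∑ i, w i • p i‖ ≤ M :=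
  calc ‖∑ i, w i • p i‖ ≤ ∑ i, w i * M := norm_sum_le_of_le _ fun i _ => by
        rw [norm_smul, Real.norm_eq_abs, abs_of_nonneg (hw i).1]
        exact mul_le_mul_of_nonneg_left (hp i) (hw i).1
    _ = M := by rw [← Finset.sum_mul, hw1, one_mul]

lemma ae_norm_velocity_sub_le (hu : IsSwitchingLaw u) (hL : ∀ i, LipschitzWith L (Ψ i)) :
    ∀ᵐ s : ℝ, 0 ≤ s →
      ‖velocity Ψ u x s - velocity Ψ u y s‖ ≤ L * ‖x s.toNNReal - y s.toNNReal‖ := by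
  filter_upwards [ae_of_law hu] with s hs h0
  simp only [velocity, ← Finset.sum_sub_distrib, ← smul_sub]
  exact norm_sum_smul_le (hs h0).1 (hs h0).2 fun i => (hL i).norm_sub_le _ _

lemma norm_integral_velocity_sub_le [CompleteSpace E] (hu : IsSwitchingLaw u)
    (hL : ∀ i, LipschitzWith L (Ψ i)) {M : ℝ≥0} (hx : LipschitzWith M x) {s r : ℝ≥0} (h : s ≤ r) :
    ‖(∫ τ in (s : ℝ)..r, velocity Ψ u x τ) - ∑ i, (∫ τ in (s : ℝ)..r, u i τ) • Ψ i (x s)‖ ≤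
      L * M * ((r : ℝ) - s) ^ 2 := by
  have hconst : ∑ i, (∫ τ in (s : ℝ)..r, u i τ) • Ψ i (x s) =
      ∫ τ in (s : ℝ)..r, velocity Ψ u (fun _ => x s) τ := by
    unfold velocity
    rw [intervalIntegral.integral_finsetSum]
    · simp only [intervalIntegral.integral_smul_const]
    · exact fun i _ => (intervalIntegrable_law hu i s r).smul_continuousOn continuousOn_const
  rw [hconst, ← intervalIntegral.integral_sub
    (intervalIntegrable_velocity hu (fun i => (hL i).continuous) hx.continuous s r)
    (intervalIntegrable_velocity hu (fun i => (hL i).continuous) continuous_const s r)]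
  have hsr : (s : ℝ) ≤ r := NNReal.coe_le_coe.2 h
  have := intervalIntegral.norm_integral_le_of_norm_le_const_ae (a := (s : ℝ)) (b := r)
    (C := L * (M * (r - s)))
    (f := fun τ => velocity Ψ u x τ - velocity Ψ u (fun _ => x s) τ) (by
      filter_upwards [ae_norm_velocity_sub_le (x := x) (y := fun _ => x s) hu hL] with τ hτ hm
      rw [Set.uIoc_of_le hsr] at hm
      have h0 : 0 ≤ τ := s.2.trans hm.1.le
      refine (hτ h0).trans ?_
      gcongr
      rw [← dist_eq_norm]
      refine hx.dist_le_mul_of_le ?_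
      rw [NNReal.dist_eq, Real.coe_toNNReal _ h0, abs_of_nonneg (by linarith [hm.1])]
      linarith [hm.2])
  rw [abs_of_nonneg (sub_nonneg.2 hsr)] at this
  linarith

end Law

/-- Monotone `1`-Lipschitz functions that sum to the identity are the primitives of a
switching law. -/
lemma exists_law {N : ℕ} {F : Fin N → ℝ≥0 → ℝ} (hF0 : ∀ i, F i 0 = 0)
    (hF : ∀ i, ∀ s r : ℝ≥0, s ≤ r → F i r - F i s ∈ Set.Icc (0 : ℝ) (r - s))
    (hsum : ∀ t, ∑ i, F i t = t) :
    ∃ u : Fin N → ℝ → ℝ, IsSwitchingLaw u ∧ ∀ i t, ∫ s in (0 : ℝ)..(t : ℝ≥0), u i s = F i t := by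
  set G : Fin N → ℝ → ℝ := fun i s => F i s.toNNReal with hG
  have hmono : ∀ i, Monotone (G i) := fun i s r h =>
    sub_nonneg.1 (hF i _ _ (Real.toNNReal_le_toNNReal h)).1
  have hlip : ∀ i, LipschitzWith 1 (G i) := by
    refine fun i => LipschitzWith.of_le_add fun r s => ?_
    rcases le_total s r with h | h
    · have h1 := (hF i _ _ (Real.toNNReal_le_toNNReal h)).2
      have h2 : ((r.toNNReal : ℝ) - s.toNNReal) ≤ dist r s := by
        rw [Real.coe_toNNReal', Real.coe_toNNReal', Real.dist_eq]
        exact (le_abs_self _).trans ((abs_max_sub_max_le_max _ _ _ _).trans (by simp))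
      simp only [hG]; linarith
    · exact (hmono i h).trans (le_add_of_nonneg_right dist_nonneg)
  refine ⟨fun i => deriv (G i), ⟨fun i => measurable_deriv _, ?_⟩, fun i t => ?_⟩
  · rw [ae_restrict_iff' measurableSet_Ici]
    have hne : ∀ᵐ s : ℝ, s ≠ 0 := by simp [ae_iff]
    filter_upwards [ae_all_iff.2 fun i => (hlip i).ae_differentiableAt, hne] with s hs hs0 hm
    refine ⟨fun i => ⟨(hmono i).deriv_nonneg, ?_⟩, ?_⟩
    · simpa using (le_abs_self _).trans (norm_deriv_le_of_lipschitz (x₀ := s) (hlip i))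
    · have hpos : 0 < s := lt_of_le_of_ne hm (Ne.symm hs0)
      rw [← deriv_fun_sum fun i _ => hs i]
      have : (fun r => ∑ i, G i r) =ᶠ[𝓝 s] id := by
        filter_upwards [Ioi_mem_nhds hpos] with r hr
        simp only [hG, hsum, id]
        exact Real.coe_toNNReal _ (le_of_lt hr)
      rw [this.deriv_eq, deriv_id]
  · rw [((hlip i).lipschitzOnWith.absolutelyContinuousOnInterval).integral_deriv_eq_sub]
    simp [hG, hF0]

section Trajectory

variable {d N : ℕ} {Ψ : Fin N → EuclideanSpace ℝ (Fin d) → EuclideanSpace ℝ (Fin d)}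
  {u : Fin N → ℝ → ℝ} {x y : ℝ≥0 → EuclideanSpace ℝ (Fin d)} {L : ℝ≥0}

lemma isTrajectoryWith_iff : IsTrajectoryWith Ψ u x ↔ Continuous x ∧ IsSwitchingLaw u ∧
    ∀ t : ℝ≥0, x t = x 0 + ∫ s in (0 : ℝ)..t, velocity Ψ u x s := by
  simp only [IsTrajectoryWith, velocity, intervalIntegral.integral_of_le (NNReal.coe_nonneg _)]

lemma sub_eq_integral (hΨ : ∀ i, Continuous (Ψ i)) (hx : IsTrajectoryWith Ψ u x) (s r : ℝ≥0) :
    x r - x s = ∫ τ in (s : ℝ)..r, velocity Ψ u x τ := by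
  obtain ⟨hc, hu, h⟩ := isTrajectoryWith_iff.1 hx
  have hInt := intervalIntegrable_velocity hu hΨ hc 0
  rw [← intervalIntegral.integral_interval_sub_left (a := 0) (by simpa using hInt r)
    (by simpa using hInt s), h r, h s, add_sub_add_left_eq_sub]

lemma lipschitzWith_of_norm_le (hΨ : ∀ i, Continuous (Ψ i)) (hx : IsTrajectoryWith Ψ u x)
    {M : ℝ≥0} (hM : ∀ i t, ‖Ψ i (x t)‖ ≤ M) : LipschitzWith M x := by
  refine LipschitzWith.of_dist_le_mul fun r s => ?_
  rw [dist_eq_norm, sub_eq_integral hΨ hx, NNReal.dist_eq]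
  refine intervalIntegral.norm_integral_le_of_norm_le_const_ae ?_
  filter_upwards [ae_of_law hx.2.1] with τ hτ hm
  have h0 : 0 ≤ τ := (le_min s.2 r.2).trans hm.1.le
  exact norm_sum_smul_le (hτ h0).1 (hτ h0).2 fun i => hM i _

/-- A Lipschitz curve whose increments agree to second order with those prescribed by a switching
law is a trajectory. -/
lemma isTrajectoryWith_of_norm_sub_le (hL : ∀ i, LipschitzWith L (Ψ i)) (hu : IsSwitchingLaw u)
    {M : ℝ≥0} (hx : LipschitzWith M x) {C : ℝ}
    (hC : ∀ s r : ℝ≥0, s ≤ r →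
      ‖x r - x s - ∑ i, (∫ τ in (s : ℝ)..r, u i τ) • Ψ i (x s)‖ ≤ C * ((r : ℝ) - s) ^ 2) :
    IsTrajectoryWith Ψ u x := by
  refine isTrajectoryWith_iff.2 ⟨hx.continuous, hu, fun t => ?_⟩
  have hInt := intervalIntegrable_velocity hu (fun i => (hL i).continuous) hx.continuous 0
  have := eq_of_norm_sub_le_sq (f := fun t : ℝ≥0 => x t - ∫ s in (0 : ℝ)..t, velocity Ψ u x s)
    (C := C + L * M) (fun s r hsr => ?_) t
  · simpa [sub_eq_iff_eq_add] using this
  · have h1 := norm_integral_velocity_sub_le hu hL hx hsr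
    have h2 := norm_sub_le_of_le (hC s r hsr) h1
    rw [← intervalIntegral.integral_interval_sub_left (a := 0) (by simpa using hInt r)
      (by simpa using hInt s)] at h2
    rw [add_mul]
    refine le_of_eq_of_le (congrArg _ ?_) h2
    abel

lemma isTrajectory_smul (hhom : ∀ (i : Fin N) (c : ℝ), 0 ≤ c → ∀ v, Ψ i (c • v) = c • Ψ i v)
    (hx : IsTrajectory Ψ x) {c : ℝ} (hc : 0 ≤ c) : IsTrajectory Ψ fun t => c • x t := by
  obtain ⟨u, hx⟩ := hx
  obtain ⟨hxc, hu, h⟩ := isTrajectoryWith_iff.1 hx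
  refine ⟨u, isTrajectoryWith_iff.2 ⟨hxc.const_smul c, hu, fun t => ?_⟩⟩
  have : velocity Ψ u (fun t => c • x t) = fun s => c • velocity Ψ u x s := by
    funext s
    simp only [velocity, hhom _ c hc, Finset.smul_sum, smul_comm c]
  rw [this, intervalIntegral.integral_smul, h t, smul_add]

lemma isTrajectory_concat (hΨ : ∀ i, Continuous (Ψ i)) (hx : IsTrajectory Ψ x)
    (hy : IsTrajectory Ψ y) {T : ℝ≥0} (hT : y 0 = x T) :
    IsTrajectory Ψ fun t => if t ≤ T then x t else y (t - T) := by
  obtain ⟨u, hx⟩ := hx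
  obtain ⟨w, hy⟩ := hy
  obtain ⟨hxc, hu, hx⟩ := isTrajectoryWith_iff.1 hx
  obtain ⟨hyc, hw, hy⟩ := isTrajectoryWith_iff.1 hy
  set z : ℝ≥0 → EuclideanSpace ℝ (Fin d) := fun t => if t ≤ T then x t else y (t - T) with hz
  set v : Fin N → ℝ → ℝ := fun i s => if s ≤ T then u i s else w i (s - T) with hv
  have hzc : Continuous z :=
    Continuous.if_le hxc (hyc.comp (continuous_id.sub continuous_const)) continuous_id
      continuous_const fun t ht => by simp [ht, hT]
  have hvl : IsSwitchingLaw v := by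
    refine ⟨fun i => Measurable.ite measurableSet_Iic (hu.1 i)
      ((hw.1 i).comp (measurable_id.sub_const _)), ?_⟩
    rw [ae_restrict_iff' measurableSet_Ici]
    filter_upwards [ae_of_law hu, (measurePreserving_sub_right volume
      (T : ℝ)).quasiMeasurePreserving.ae (ae_of_law hw)] with s h1 h2 h0
    by_cases hs : s ≤ T
    · simpa [hv, hs] using h1 h0
    · simpa [hv, hs] using h2 (by linarith)
  have hleft : ∀ s : ℝ, s ≤ T → velocity Ψ v z s = velocity Ψ u x s := by
    intro s hs
    have : s.toNNReal ≤ T := Real.toNNReal_le_iff_le_coe.2 hs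
    simp [velocity, hv, hz, hs, this]
  have hright : ∀ s : ℝ, T < s → velocity Ψ v z s = velocity Ψ w y (s - T) := by
    intro s hs
    have h1 : ¬ s ≤ T := not_le.2 hs
    have h2 : ¬ s.toNNReal ≤ T := by rwa [Real.toNNReal_le_iff_le_coe]
    have h3 : (s - T).toNNReal = s.toNNReal - T := by
      rw [NNReal.sub_def, Real.coe_toNNReal s (T.2.trans hs.le)]
    simp [velocity, hv, hz, h1, h2, h3]
  have hz0 : z 0 = x 0 := by simp [hz]
  have hbefore : ∀ t : ℝ≥0, t ≤ T → x t = z 0 + ∫ s in (0 : ℝ)..t, velocity Ψ v z s := by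
    intro t ht
    rw [hz0, hx t]
    congr 1
    refine intervalIntegral.integral_congr fun s hs => (hleft s ?_).symm
    rw [Set.uIcc_of_le (NNReal.coe_nonneg t)] at hs
    exact hs.2.trans (NNReal.coe_le_coe.2 ht)
  refine ⟨v, isTrajectoryWith_iff.2 ⟨hzc, hvl, fun t => ?_⟩⟩
  by_cases ht : t ≤ T
  · rw [← hbefore t ht]
    simp [hz, ht]
  · have htT : (T : ℝ) ≤ t := NNReal.coe_le_coe.2 (le_of_not_ge ht)
    have hInt := intervalIntegrable_velocity hvl hΨ hzc
    rw [← intervalIntegral.integral_add_adjacent_intervals (by simpa using hInt 0 T) (hInt T t),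
      ← add_assoc, ← hbefore T le_rfl]
    have : ∫ s in (T : ℝ)..t, velocity Ψ v z s = ∫ s in (T : ℝ)..t, velocity Ψ w y (s - T) := by
      refine intervalIntegral.integral_congr_ae (Eventually.of_forall fun s hs => hright s ?_)
      rw [Set.uIoc_of_le htT] at hs
      exact hs.1
    rw [this, intervalIntegral.integral_comp_sub_right, sub_self, ← hT,
      ← NNReal.coe_sub (le_of_not_ge ht), ← hy]
    simp [hz, ht]

lemma norm_integral_velocity_sub_le_exp (hu : IsSwitchingLaw u)
    (hL : ∀ i, LipschitzWith L (Ψ i)) {D : ℝ}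
    (h : ∀ s : ℝ≥0, ‖x s - y s‖ ≤ D * Real.exp ((2 * L + 1) * s)) (t : ℝ≥0) :
    ‖∫ s in (0 : ℝ)..t, (velocity Ψ u x s - velocity Ψ u y s)‖ ≤
      D / 2 * Real.exp ((2 * L + 1) * t) := by
  have hD : 0 ≤ D := by simpa using (norm_nonneg _).trans (h 0)
  have ha : (0 : ℝ) < 2 * L + 1 := by positivity
  calc ‖∫ s in (0 : ℝ)..t, (velocity Ψ u x s - velocity Ψ u y s)‖
      ≤ ∫ s in (0 : ℝ)..t, L * D * Real.exp ((2 * L + 1) * s) := by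
        refine intervalIntegral.norm_integral_le_of_norm_le t.2 ?_
          (Continuous.intervalIntegrable (by fun_prop) _ _)
        filter_upwards [ae_norm_velocity_sub_le (x := x) (y := y) hu hL] with s hs hm
        refine (hs hm.1.le).trans ?_
        rw [mul_assoc]
        gcongr
        simpa [Real.coe_toNNReal _ hm.1.le] using h s.toNNReal
    _ = L * D * ((2 * L + 1 : ℝ)⁻¹ * (Real.exp ((2 * L + 1) * t) - 1)) := by
        rw [intervalIntegral.integral_const_mul,
          intervalIntegral.integral_comp_mul_left (fun s => Real.exp s) ha.ne', integral_exp]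
        simp
    _ = L / (2 * L + 1) * (D * (Real.exp ((2 * L + 1) * t) - 1)) := by ring
    _ ≤ 1 / 2 * (D * Real.exp ((2 * L + 1) * t)) := by
        have h1 : (L : ℝ) / (2 * L + 1) ≤ 1 / 2 := by
          rw [div_le_div_iff₀ ha two_pos]; linarith
        have h2 : (1 : ℝ) ≤ Real.exp ((2 * L + 1) * t) := Real.one_le_exp (by positivity)
        gcongr
        linarith
    _ = _ := by ring

/-- Every initial condition is the start of a trajectory with a given switching law, and such
trajectories depend in a Lipschitz way on the initial condition. -/
lemma exists_trajectory_norm_sub_le (hL : ∀ i, LipschitzWith L (Ψ i))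
    (hx : IsTrajectoryWith Ψ u x) (q : EuclideanSpace ℝ (Fin d)) :
    ∃ y, IsTrajectoryWith Ψ u y ∧ y 0 = q ∧
      ∀ t : ℝ≥0, ‖y t - x t‖ ≤ 2 * ‖q - x 0‖ * Real.exp ((2 * L + 1) * t) := by
  obtain ⟨hxc, hu, hx⟩ := isTrajectoryWith_iff.1 hx
  have hΨ : ∀ i, Continuous (Ψ i) := fun i => (hL i).continuous
  set a : ℝ := 2 * L + 1 with ha
  have hexp : ∀ t : ℝ, Real.exp (-(a * t)) * Real.exp (a * t) = 1 := fun t => by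
    rw [← Real.exp_add]; simp
  let Y : BoundedContinuousFunction ℝ≥0 (EuclideanSpace ℝ (Fin d)) →
    ℝ≥0 → EuclideanSpace ℝ (Fin d) := fun f t => x t + Real.exp (a * t) • f t
  have hY : ∀ f, Continuous (Y f) := fun f => by
    have := f.continuous
    fun_prop
  have hInt : ∀ y : ℝ≥0 → EuclideanSpace ℝ (Fin d), Continuous y → ∀ t : ℝ≥0,
      IntervalIntegrable (velocity Ψ u y) volume 0 t := fun y hy t => by
    simpa using intervalIntegrable_velocity hu hΨ hy 0 t
  have hYx : ∀ f (s : ℝ≥0), ‖Y f s - x s‖ ≤ ‖f‖ * Real.exp (a * s) := fun f s => by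
    simp only [Y, add_sub_cancel_left, norm_smul, Real.norm_eq_abs, Real.abs_exp]
    rw [mul_comm]
    gcongr
    exact f.norm_coe_le_norm s
  have hYY : ∀ f g (s : ℝ≥0), ‖Y f s - Y g s‖ ≤ dist f g * Real.exp (a * s) := fun f g s => by
    simp only [Y, add_sub_add_left_eq_sub, ← smul_sub, norm_smul, Real.norm_eq_abs, Real.abs_exp]
    rw [mul_comm, ← dist_eq_norm]
    gcongr
    exact f.dist_coe_le_dist s
  let T₀ : BoundedContinuousFunction ℝ≥0 (EuclideanSpace ℝ (Fin d)) →
    ℝ≥0 → EuclideanSpace ℝ (Fin d) := fun f t => Real.exp (-(a * t)) •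
      (q - x 0 + ∫ s in (0 : ℝ)..t, (velocity Ψ u (Y f) s - velocity Ψ u x s))
  have hT₀c : ∀ f, Continuous (T₀ f) := fun f => by
    have := continuous_primitive fun t => (hInt _ (hY f) t).sub (hInt x hxc t)
    fun_prop
  have hT₀b : ∀ f t, ‖T₀ f t‖ ≤ ‖q - x 0‖ + ‖f‖ / 2 := fun f t => by
    have h1 := norm_integral_velocity_sub_le_exp hu hL (hYx f) t
    have h2 : Real.exp (-(a * t)) ≤ 1 := Real.exp_le_one_iff.2 (neg_nonpos.2 (by positivity))
    simp only [T₀, norm_smul, Real.norm_eq_abs, Real.abs_exp]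
    calc _ ≤ Real.exp (-(a * t)) * (‖q - x 0‖ + ‖f‖ / 2 * Real.exp (a * t)) := by
          gcongr
          exact norm_add_le_of_le le_rfl h1
      _ = Real.exp (-(a * t)) * ‖q - x 0‖ + ‖f‖ / 2 := by
          linear_combination (‖f‖ / 2) * hexp t
      _ ≤ _ := by
          gcongr
          exact mul_le_of_le_one_left (norm_nonneg _) h2
  let T : BoundedContinuousFunction ℝ≥0 (EuclideanSpace ℝ (Fin d)) →
    BoundedContinuousFunction ℝ≥0 (EuclideanSpace ℝ (Fin d)) := fun f =>
      BoundedContinuousFunction.ofNormedAddCommGroup (T₀ f) (hT₀c f) _ (hT₀b f)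
  have hT : ContractingWith (1 / 2) T := by
    refine ⟨by rw [← NNReal.coe_lt_coe]; norm_num, LipschitzWith.of_dist_le_mul fun f g => ?_⟩
    refine (BoundedContinuousFunction.dist_le (by positivity)).2 fun t => ?_
    have h1 := norm_integral_velocity_sub_le_exp hu hL (hYY f g) t
    have h2 : T f t - T g t = Real.exp (-(a * t)) •
        ∫ s in (0 : ℝ)..t, (velocity Ψ u (Y f) s - velocity Ψ u (Y g) s) := by
      change T₀ f t - T₀ g t = _
      simp only [T₀]
      rw [← smul_sub, intervalIntegral.integral_sub (hInt _ (hY f) t) (hInt x hxc t),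
        intervalIntegral.integral_sub (hInt _ (hY g) t) (hInt x hxc t),
        intervalIntegral.integral_sub (hInt _ (hY f) t) (hInt _ (hY g) t)]
      congr 1
      abel
    rw [dist_eq_norm, h2, norm_smul, Real.norm_eq_abs, Real.abs_exp]
    calc _ ≤ Real.exp (-(a * t)) * (dist f g / 2 * Real.exp (a * t)) := by gcongr
      _ = dist f g / 2 := by linear_combination (dist f g / 2) * hexp t
      _ = _ := by push_cast; ring
  obtain ⟨f, hf⟩ : ∃ f, T f = f := ⟨_, hT.fixedPoint_isFixedPt⟩
  have hft : ∀ t : ℝ≥0, Real.exp (a * t) • f t =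
      q - x 0 + ∫ s in (0 : ℝ)..t, (velocity Ψ u (Y f) s - velocity Ψ u x s) := fun t => by
    have : f t = T₀ f t := (DFunLike.congr_fun hf t).symm
    rw [this]
    simp only [T₀]
    rw [smul_smul, mul_comm, hexp, one_smul]
  have hY0 : Y f 0 = q := by
    have := hft 0
    simp only [Y]
    rw [this]
    simp
  have hfn : ‖f‖ ≤ 2 * ‖q - x 0‖ := by
    have : ‖f‖ ≤ ‖q - x 0‖ + ‖f‖ / 2 :=
      (BoundedContinuousFunction.norm_le (by positivity)).2 fun t => by
        have : f t = T₀ f t := (DFunLike.congr_fun hf t).symm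
        exact this ▸ hT₀b f t
    linarith
  refine ⟨Y f, isTrajectoryWith_iff.2 ⟨hY f, hu, fun t => ?_⟩, hY0, fun t => ?_⟩
  · rw [hY0]
    change x t + Real.exp (a * t) • f t = _
    rw [hft, hx t, intervalIntegral.integral_sub (hInt _ (hY f) t) (hInt x hxc t)]
    abel
  · exact (hYx f t).trans (by gcongr)

end Trajectory

section Limit

variable {d N : ℕ} {Ψ : Fin N → EuclideanSpace ℝ (Fin d) → EuclideanSpace ℝ (Fin d)}
  {u : Fin N → ℝ → ℝ} {x : ℝ≥0 → EuclideanSpace ℝ (Fin d)} {L : ℝ≥0}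
  {Z : Set (EuclideanSpace ℝ (Fin d))}

lemma integral_law_mem_Icc (hu : IsSwitchingLaw u) (i : Fin N) {s r : ℝ≥0} (h : s ≤ r) :
    ∫ τ in (s : ℝ)..r, u i τ ∈ Set.Icc (0 : ℝ) (r - s) := by
  have hsr : (s : ℝ) ≤ r := NNReal.coe_le_coe.2 h
  have hmem : ∀ᵐ τ ∂volume.restrict (Set.Icc (s : ℝ) r), u i τ ∈ Set.Icc (0 : ℝ) 1 := by
    rw [ae_restrict_iff' measurableSet_Icc]
    filter_upwards [ae_of_law hu] with τ hτ hm
    exact (hτ (s.2.trans hm.1)).1 i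
  refine ⟨intervalIntegral.integral_nonneg_of_ae_restrict hsr (hmem.mono fun τ h => h.1), ?_⟩
  have := intervalIntegral.integral_mono_ae_restrict hsr (intervalIntegrable_law hu i s r)
    (intervalIntegrable_const (c := (1 : ℝ))) (hmem.mono fun τ h => h.2)
  simpa using this

lemma sum_integral_law (hu : IsSwitchingLaw u) {s r : ℝ≥0} (h : s ≤ r) :
    ∑ i, ∫ τ in (s : ℝ)..r, u i τ = r - s := by
  have hsr : (s : ℝ) ≤ r := NNReal.coe_le_coe.2 h
  rw [← intervalIntegral.integral_finsetSum fun i _ => intervalIntegrable_law hu i s r]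
  have : ∫ τ in (s : ℝ)..r, ∑ i, u i τ = ∫ τ in (s : ℝ)..r, (1 : ℝ) := by
    refine intervalIntegral.integral_congr_ae ?_
    filter_upwards [ae_of_law hu] with τ hτ hm
    rw [Set.uIoc_of_le hsr] at hm
    exact (hτ (s.2.trans hm.1.le)).2
  simpa using this

/-- Limits of time shifts: a point in the orbit closure of a trajectory in a compact set `Z` is
itself the start of a trajectory in `Z`. -/
lemma exists_trajectory_of_mem_closure_range (hL : ∀ i, LipschitzWith L (Ψ i))
    (hZ : IsCompact Z) (hx : IsTrajectory Ψ x) (hxZ : ∀ t, x t ∈ Z)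
    {v : EuclideanSpace ℝ (Fin d)} (hv : v ∈ closure (Set.range x)) :
    ∃ y, IsTrajectory Ψ y ∧ (∀ t, y t ∈ Z) ∧ y 0 = v := by
  obtain ⟨u, hx⟩ := hx
  have hΨ : ∀ i, Continuous (Ψ i) := fun i => (hL i).continuous
  have hu := hx.2.1
  obtain ⟨M, hM⟩ : ∃ M : ℝ≥0, ∀ i t, ‖Ψ i (x t)‖ ≤ M := by
    choose B hB using fun i => hZ.exists_bound_of_continuousOn (hΨ i).continuousOn
    refine ⟨∑ i, (B i).toNNReal, fun i t => (hB i _ (hxZ t)).trans ?_⟩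
    exact (Real.le_coe_toNNReal _).trans (NNReal.coe_le_coe.2
      (Finset.single_le_sum (f := fun i => (B i).toNNReal) (fun _ _ => zero_le)
        (Finset.mem_univ i)))
  have hlip := lipschitzWith_of_norm_le hΨ hx hM
  have hne : (comap x (𝓝 v)).NeBot := comap_neBot_iff.2 fun t ht => by
    obtain ⟨_, hp, τ, rfl⟩ := mem_closure_iff_nhds.1 hv t ht
    exact ⟨τ, hp⟩
  let l : Ultrafilter ℝ≥0 := Ultrafilter.of (comap x (𝓝 v))
  have hl : Tendsto x l (𝓝 v) := tendsto_comap.mono_left (Ultrafilter.of_le _)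
  choose y hyZ hy using fun t => hZ.ultrafilter_le_nhds' (l.map fun τ : ℝ≥0 => x (τ + t))
    (Ultrafilter.mem_map.2 (univ_mem' fun τ => hxZ (τ + t)))
  replace hy : ∀ t, Tendsto (fun τ => x (τ + t)) l (𝓝 (y t)) := hy
  have hInt : ∀ i (τ t : ℝ≥0), ∫ s in (τ : ℝ)..(τ + t : ℝ≥0), u i s ∈ Set.Icc (0 : ℝ) t :=
    fun i τ t => by simpa using integral_law_mem_Icc hu i (le_self_add : τ ≤ τ + t)
  choose F hFmem hF using fun i (t : ℝ≥0) =>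
    (isCompact_Icc (a := (0 : ℝ)) (b := t)).ultrafilter_le_nhds'
      (l.map fun τ : ℝ≥0 => ∫ s in (τ : ℝ)..(τ + t : ℝ≥0), u i s)
      (Ultrafilter.mem_map.2 (univ_mem' fun τ => hInt i τ t))
  replace hF : ∀ i (t : ℝ≥0),
    Tendsto (fun τ : ℝ≥0 => ∫ s in (τ : ℝ)..(τ + t : ℝ≥0), u i s) l (𝓝 (F i t)) := hF
  have hFsub : ∀ i (s r : ℝ≥0), Tendsto
      (fun τ : ℝ≥0 => ∫ σ in ((τ + s : ℝ≥0) : ℝ)..(τ + r : ℝ≥0), u i σ) l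
      (𝓝 (F i r - F i s)) := fun i s r => by
    refine ((hF i r).sub (hF i s)).congr fun τ => ?_
    exact intervalIntegral.integral_interval_sub_left (intervalIntegrable_law hu i _ _)
      (intervalIntegrable_law hu i _ _)
  obtain ⟨w, hw, hwF⟩ := exists_law (F := F)
    (fun i => by simpa using hFmem i 0)
    (fun i s r hsr => isClosed_Icc.mem_of_tendsto (hFsub i s r) (Eventually.of_forall fun τ => by
      simpa using integral_law_mem_Icc hu i (add_le_add_right hsr τ)))
    (fun t => tendsto_nhds_unique (tendsto_finsetSum _ fun i _ => hF i t)
      (tendsto_const_nhds.congr fun τ => by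
        simpa using (sum_integral_law hu (le_self_add : τ ≤ τ + t)).symm))
  have hylip : LipschitzWith M y := LipschitzWith.of_dist_le_mul fun r s =>
    le_of_tendsto ((hy r).dist (hy s)) (Eventually.of_forall fun τ =>
      (hlip.dist_le_mul _ _).trans_eq (by simp [NNReal.dist_eq]))
  refine ⟨y, ⟨w, isTrajectoryWith_of_norm_sub_le hL hw hylip (C := L * M) fun s r hsr => ?_⟩,
    hyZ, tendsto_nhds_unique (by simpa using hy 0) hl⟩
  have hwsub : ∀ i, ∫ τ in (s : ℝ)..r, w i τ = F i r - F i s := fun i => by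
    rw [← hwF, ← hwF, intervalIntegral.integral_interval_sub_left]
    · simpa using intervalIntegrable_law hw i 0 r
    · simpa using intervalIntegrable_law hw i 0 s
  simp only [hwsub]
  refine le_of_tendsto (((hy r).sub (hy s)).sub (tendsto_finsetSum _ fun i _ =>
    (hFsub i s r).smul (((hΨ i).tendsto _).comp (hy s)))).norm (Eventually.of_forall fun τ => ?_)
  have := norm_integral_velocity_sub_le hu hL hlip (add_le_add_right hsr τ)
  rw [← sub_eq_integral hΨ hx] at this
  simpa using this

end Limit

section Minimal

variable {d N : ℕ} {Ψ : Fin N → EuclideanSpace ℝ (Fin d) → EuclideanSpace ℝ (Fin d)}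
  {L : ℝ≥0} {Z : Set (EuclideanSpace ℝ (Fin d))} {C : ℝ}

/-- The norms of the points reachable from `p`. -/
def reachableNorms (Ψ : Fin N → EuclideanSpace ℝ (Fin d) → EuclideanSpace ℝ (Fin d))
    (p : EuclideanSpace ℝ (Fin d)) : Set ℝ :=
  {m | ∃ x, IsTrajectory Ψ x ∧ x 0 = p ∧ ∃ t, ‖x t‖ = m}

lemma bddAbove_reachableNorms (hC : ∀ x, IsTrajectory Ψ x → ∀ t, ‖x t‖ ≤ C * ‖x 0‖)
    (p : EuclideanSpace ℝ (Fin d)) : BddAbove (reachableNorms Ψ p) :=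
  ⟨C * ‖p‖, by rintro _ ⟨x, hx, rfl, t, rfl⟩; exact hC x hx t⟩

/-- A bound on the norms reachable from `x 0` also bounds those reachable from any point of the
orbit closure of `x`. -/
lemma le_of_mem_closure_range (hL : ∀ i, LipschitzWith L (Ψ i))
    {x : ℝ≥0 → EuclideanSpace ℝ (Fin d)} (hx : IsTrajectory Ψ x) {q : EuclideanSpace ℝ (Fin d)}
    (hq : q ∈ closure (Set.range x)) {B : ℝ} (hB : B ∈ upperBounds (reachableNorms Ψ (x 0))) :
    B ∈ upperBounds (reachableNorms Ψ q) := by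
  rintro _ ⟨y, ⟨u, hy⟩, rfl, t, rfl⟩
  refine le_of_forall_pos_le_add fun ε hε => ?_
  set K : ℝ := 2 * Real.exp ((2 * L + 1) * t) with hK
  have hKpos : 0 < K := by positivity
  obtain ⟨_, ⟨τ, rfl⟩, hτ⟩ := Metric.mem_closure_iff.1 hq (ε / K) (by positivity)
  obtain ⟨z, hz, hz0, hzy⟩ := exists_trajectory_norm_sub_le hL hy (x τ)
  have hzt : ‖z t‖ ≤ B := by
    refine hB ⟨_, isTrajectory_concat (fun i => (hL i).continuous) hx ⟨u, hz⟩ hz0, by simp,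
      τ + t, ?_⟩
    by_cases ht : τ + t ≤ τ
    · have : t = 0 := by simpa using ht
      simp [this, hz0]
    · simp [ht]
  have h1 : ‖y t‖ ≤ ‖z t‖ + ‖z t - y t‖ := by
    simpa [norm_sub_rev] using norm_le_norm_add_norm_sub' (y t) (z t)
  have h2 : 2 * ‖x τ - y 0‖ * Real.exp ((2 * L + 1) * t) ≤ ε := by
    rw [dist_comm, dist_eq_norm, lt_div_iff₀ hKpos] at hτ
    linarith
  linarith [hzy t]

open scoped Pointwise in
lemma sSup_reachableNorms_smul
    (hhom : ∀ (i : Fin N) (c : ℝ), 0 ≤ c → ∀ v, Ψ i (c • v) = c • Ψ i v)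
    {c : ℝ} (hc : 0 < c) (p : EuclideanSpace ℝ (Fin d)) :
    sSup (reachableNorms Ψ (c • p)) = c * sSup (reachableNorms Ψ p) := by
  have hsub : ∀ {c : ℝ}, 0 < c → ∀ p, c • reachableNorms Ψ p ⊆ reachableNorms Ψ (c • p) := by
    rintro c hc p _ ⟨_, ⟨x, hx, rfl, t, rfl⟩, rfl⟩
    exact ⟨_, isTrajectory_smul hhom hx hc.le, rfl, t, by simp [norm_smul, abs_of_pos hc]⟩
  have : reachableNorms Ψ (c • p) = c • reachableNorms Ψ p := by
    refine Set.Subset.antisymm ?_ (hsub hc p)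
    rw [Set.subset_smul_set_iff₀ hc.ne']
    simpa [smul_smul, hc.ne'] using hsub (inv_pos.2 hc) (c • p)
  rw [this, Real.sSup_smul_of_nonneg hc.le, smul_eq_mul]

/-- In a minimal set, orbit closures are everything. -/
lemma closure_range_eq (hZ : IsCompact Z)
    (hmin : ∀ Z' : Set (EuclideanSpace ℝ (Fin d)), Z' ⊆ Z → Z'.Nonempty → IsCompact Z' →
      (∃ x : ℝ≥0 → EuclideanSpace ℝ (Fin d), IsTrajectory Ψ x ∧ ∀ t, x t ∈ Z') → Z' = Z)
    {x : ℝ≥0 → EuclideanSpace ℝ (Fin d)} (hx : IsTrajectory Ψ x) (hxZ : ∀ t, x t ∈ Z) :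
    closure (Set.range x) = Z := by
  have hsub : closure (Set.range x) ⊆ Z :=
    closure_minimal (Set.range_subset_iff.2 hxZ) hZ.isClosed
  exact hmin _ hsub (Set.range_nonempty x).closure (hZ.of_isClosed_subset isClosed_closure hsub)
    ⟨x, hx, fun t => subset_closure ⟨t, rfl⟩⟩

end Minimal

end SwitchedSystem

/-- A minimal compact trajectory-carrying subset `Z ⊂ ℝ^d ∖ {0}` of a Lyapunov stable
switched homogeneous system meets each ray from the origin at most once, hence the radial
projection `v ↦ v/‖v‖` restricts to a homeomorphism of `Z` onto a compact subset of the
unit sphere `S^{d-1}`. -/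
theorem minimal_set_embeds_in_sphere
    (d N : ℕ) (Ψ : Fin N → EuclideanSpace ℝ (Fin d) → EuclideanSpace ℝ (Fin d))
    (hhom : ∀ (i : Fin N) (c : ℝ), 0 ≤ c → ∀ v, Ψ i (c • v) = c • Ψ i v)
    (hlip : ∀ i, ∃ K : ℝ≥0, LipschitzWith K (Ψ i))
    (hLyap : ∃ C : ℝ, 0 < C ∧ ∀ x : ℝ≥0 → EuclideanSpace ℝ (Fin d), IsTrajectory Ψ x →
      ∀ t : ℝ≥0, ‖x t‖ ≤ C * ‖x 0‖)
    (Z : Set (EuclideanSpace ℝ (Fin d))) (hZc : IsCompact Z) (hZ0 : (0 : EuclideanSpace ℝ (Fin d)) ∉ Z)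
    (hne : ∃ x : ℝ≥0 → EuclideanSpace ℝ (Fin d), IsTrajectory Ψ x ∧ ∀ t, x t ∈ Z)
    (hmin : ∀ Z' : Set (EuclideanSpace ℝ (Fin d)), Z' ⊆ Z → Z'.Nonempty → IsCompact Z' →
      (∃ x : ℝ≥0 → EuclideanSpace ℝ (Fin d), IsTrajectory Ψ x ∧ ∀ t, x t ∈ Z') → Z' = Z) :
    Set.InjOn (fun v : EuclideanSpace ℝ (Fin d) => ‖v‖⁻¹ • v) Z ∧
    (fun v : EuclideanSpace ℝ (Fin d) => ‖v‖⁻¹ • v) '' Z ⊆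
      Metric.sphere (0 : EuclideanSpace ℝ (Fin d)) 1 ∧
    IsCompact ((fun v : EuclideanSpace ℝ (Fin d) => ‖v‖⁻¹ • v) '' Z) ∧
    ∃ e : Z ≃ₜ ((fun v : EuclideanSpace ℝ (Fin d) => ‖v‖⁻¹ • v) '' Z),
      ∀ v : Z, (e v : EuclideanSpace ℝ (Fin d)) = ‖(v : EuclideanSpace ℝ (Fin d))‖⁻¹ • (v : EuclideanSpace ℝ (Fin d)) := by
  obtain ⟨C, -, hC⟩ := hLyap
  obtain ⟨L, hL⟩ : ∃ L : ℝ≥0, ∀ i, LipschitzWith L (Ψ i) := by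
    choose K hK using hlip
    exact ⟨∑ i, K i, fun i => (hK i).weaken
      (Finset.single_le_sum (fun _ _ => zero_le) (Finset.mem_univ i))⟩
  obtain ⟨x₀, hx₀, hx₀Z⟩ := hne
  have hex : ∀ v ∈ Z, ∃ y, IsTrajectory Ψ y ∧ (∀ t, y t ∈ Z) ∧ y 0 = v := fun v hv =>
    SwitchedSystem.exists_trajectory_of_mem_closure_range hL hZc hx₀ hx₀Z
      ((SwitchedSystem.closure_range_eq hZc hmin hx₀ hx₀Z).symm ▸ hv)
  have hbdd := SwitchedSystem.bddAbove_reachableNorms hC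
  have hnonempty : ∀ v ∈ Z, ‖v‖ ∈ SwitchedSystem.reachableNorms Ψ v := fun v hv => by
    obtain ⟨y, hy, -, rfl⟩ := hex v hv
    exact ⟨y, hy, rfl, 0, rfl⟩
  have hle : ∀ p ∈ Z, ∀ q ∈ Z, sSup (SwitchedSystem.reachableNorms Ψ q) ≤
      sSup (SwitchedSystem.reachableNorms Ψ p) := fun p hp q hq => by
    obtain ⟨y, hy, hyZ, rfl⟩ := hex p hp
    refine csSup_le ⟨_, hnonempty q hq⟩ (SwitchedSystem.le_of_mem_closure_range hL hy
      ((SwitchedSystem.closure_range_eq hZc hmin hy hyZ).symm ▸ hq) ?_)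
    exact fun m hm => le_csSup (hbdd _) hm
  have hne0 : ∀ v ∈ Z, 0 < ‖v‖ := fun v hv => norm_pos_iff.2 fun h => hZ0 (h ▸ hv)
  have hinj : Set.InjOn (fun v : EuclideanSpace ℝ (Fin d) => ‖v‖⁻¹ • v) Z := by
    intro v hv w hw hvw
    have hv0 := hne0 v hv
    have hw0 := hne0 w hw
    have hvw' : v = (‖v‖ * ‖w‖⁻¹) • w := by
      rw [mul_smul]
      exact (eq_inv_smul_iff₀ hv0.ne').1 hvw.symm |>.symm
    have hscale := SwitchedSystem.sSup_reachableNorms_smul hhom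
      (show 0 < ‖v‖ * ‖w‖⁻¹ by positivity) w
    rw [← hvw', (hle w hw v hv).antisymm (hle v hv w hw)] at hscale
    have hpos : 0 < sSup (SwitchedSystem.reachableNorms Ψ w) :=
      hw0.trans_le (le_csSup (hbdd _) (hnonempty w hw))
    have : ‖v‖ * ‖w‖⁻¹ = 1 := mul_right_cancel₀ hpos.ne' (by rw [← hscale, one_mul])
    rwa [this, one_smul] at hvw'
  have hcont : ContinuousOn (fun v : EuclideanSpace ℝ (Fin d) => ‖v‖⁻¹ • v) Z :=
    (continuousOn_id.norm.inv₀ fun v hv => (hne0 v hv).ne').smul continuousOn_id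
  refine ⟨hinj, ?_, hZc.image_of_continuousOn hcont, ?_⟩
  · rintro _ ⟨v, hv, rfl⟩
    simp [norm_smul, (hne0 v hv).ne']
  · have : CompactSpace Z := isCompact_iff_compactSpace.1 hZc
    have hc : Continuous (Equiv.Set.imageOfInjOn _ Z hinj) :=
      Continuous.subtype_mk (continuousOn_iff_continuous_domRestrict.1 hcont) _
    exact ⟨hc.homeoOfEquivCompactToT2, fun v => rfl⟩
end
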